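/- arXiv:0905.3475 — 4 statements merged into one kernel-verified Lean document; each statement's English description precedes it below -/
import Mathlib

section
/- Let G be a connected finite simple graph that is not a Gallai tree. Then G is list degree colorable: for every assignment of lists L(v) of colors to the vertices with |L(v)| ≥ deg(v) for every vertex v, there exists a proper coloring of G in which each vertex v receives a color from its list L(v). -/
/-- The graph induced by `G` on `B` has no cut vertex: removing any vertex of `B`
leaves an induced subgraph that is still connected (trivially true for a single vertex). -/
def NoCutVertex {V : Type*} (G : SimpleGraph V) (B : Set V) : Prop :=
  ∀ v ∈ B, B = {v} ∨ (G.induce (B \ {v})).Connected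

/-- `B` is the vertex set of a block of `G`: a maximal set of vertices inducing a
connected subgraph with no cut vertex. -/
def IsBlock {V : Type*} (G : SimpleGraph V) (B : Set V) : Prop :=
  (G.induce B).Connected ∧ NoCutVertex G B ∧
    ∀ B' : Set V, B ⊆ B' → (G.induce B').Connected → NoCutVertex G B' → B' = B

/-- The subgraph of `G` induced on `B` is a cycle with an odd number of vertices. -/
def IsOddCycleSet {V : Type*} (G : SimpleGraph V) (B : Set V) : Prop :=
  ∃ n : ℕ, Odd n ∧ 3 ≤ n ∧ Nonempty (G.induce B ≃g SimpleGraph.cycleGraph n)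

/-- A Gallai tree: a graph each of whose blocks is a complete graph or an odd cycle. -/
def IsGallaiTree {V : Type*} (G : SimpleGraph V) : Prop :=
  ∀ B : Set V, IsBlock G B → G.IsClique B ∨ IsOddCycleSet G B


lemma greedy {V α : Type*} [Fintype V] [DecidableEq V] [DecidableEq α]
    (G : SimpleGraph V) [DecidableRel G.Adj] (L : V → Finset α)
    (hL : ∀ x : V, G.degree x ≤ (L x).card) (w : V) (r : V → ℕ) :
    ∀ (n : ℕ) (S : Finset V), S.card = n → w ∈ S →
      (∀ x ∈ S, x ≠ w → ∃ y ∈ S, G.Adj x y ∧ r y < r x) →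
      ∀ f : V → α, (∀ x ∉ S, f x ∈ L x) → (∀ x ∉ S, ∀ y ∉ S, G.Adj x y → f x ≠ f y) →
      ∃ g : V → α, (∀ x ∉ S, g x = f x) ∧ (∀ x, x ≠ w → g x ∈ L x) ∧
        ∀ x y, x ≠ w → y ≠ w → G.Adj x y → g x ≠ g y := by
  intro n
  induction n with
  | zero =>
    intro S h hw
    rw [Finset.card_eq_zero] at h
    simp [h] at hw
  | succ n ih =>
    intro S hS hw hr f hf hp
    by_cases he : (S.erase w).Nonempty
    · obtain ⟨x, hx, hmax⟩ := Finset.exists_max_image (S.erase w) r he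
      rw [Finset.mem_erase] at hx
      obtain ⟨y0, hy0, hxy0, _⟩ := hr x hx.2 hx.1
      have hcard : (((G.neighborFinset x).erase y0).image f).card < (L x).card := by
        refine lt_of_le_of_lt Finset.card_image_le ?_
        have : y0 ∈ G.neighborFinset x := by simpa using hxy0
        rw [Finset.card_erase_of_mem this]
        have h1 := hL x
        have h2 : 0 < (G.neighborFinset x).card := Finset.card_pos.2 ⟨_, this⟩
        rw [G.card_neighborFinset_eq_degree] at *
        omega
      obtain ⟨c, hc, hc'⟩ := Finset.exists_mem_notMem_of_card_lt_card hcard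
      have hc'' : ∀ y ∉ S, G.Adj x y → f y ≠ c := by
        intro y hy hxy e
        apply hc'
        rw [Finset.mem_image]
        refine ⟨y, ?_, e⟩
        rw [Finset.mem_erase]
        refine ⟨?_, by simpa using hxy⟩
        rintro rfl; exact hy hy0
      obtain ⟨g, h1, h2, h3⟩ := ih (S.erase x) (by rw [Finset.card_erase_of_mem hx.2]; omega)
        (by rw [Finset.mem_erase]; exact ⟨Ne.symm hx.1, hw⟩)
        (by
          intro z hz hzw
          rw [Finset.mem_erase] at hz
          obtain ⟨y, hy, hzy, hlt⟩ := hr z hz.2 hzw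
          refine ⟨y, ?_, hzy, hlt⟩
          rw [Finset.mem_erase]
          refine ⟨?_, hy⟩
          rintro rfl
          have := hmax z (by rw [Finset.mem_erase]; exact ⟨hzw, hz.2⟩)
          omega)
        (Function.update f x c)
        (by
          intro z hz
          by_cases hzx : z = x
          · subst hzx; simpa using hc
          · rw [Function.update_of_ne hzx]
            apply hf; intro h; exact hz (Finset.mem_erase.2 ⟨hzx, h⟩))
        (by
          intro a ha b hb hab
          simp only [Finset.mem_erase, not_and] at ha hb
          by_cases hax : a = x
          · subst hax
            have hba : b ≠ a := fun h => G.loopless.irrefl _ (h ▸ hab)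
            rw [Function.update_self, Function.update_of_ne hba]
            exact (hc'' b (hb hba) hab).symm
          · by_cases hbx : b = x
            · subst hbx
              rw [Function.update_self, Function.update_of_ne hax]
              exact (hc'' a (ha hax) hab.symm)
            · rw [Function.update_of_ne hax, Function.update_of_ne hbx]
              exact hp a (ha hax) b (hb hbx) hab)
      refine ⟨g, ?_, h2, h3⟩
      intro z hz
      have hzx : z ≠ x := by rintro rfl; exact hz hx.2
      rw [h1 z (fun h => hz (Finset.mem_erase.1 h).2), Function.update_of_ne hzx]
    · have hS' : ∀ x, x ≠ w → x ∉ S := by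
        intro x hx hxS
        exact he ⟨x, Finset.mem_erase.2 ⟨hx, hxS⟩⟩
      exact ⟨f, fun _ _ => rfl, fun x hx => hf x (hS' x hx),
        fun x y hx hy => hp x (hS' x hx) y (hS' y hy)⟩

lemma finish {V α : Type*} [Fintype V] [DecidableEq V] [DecidableEq α]
    (G : SimpleGraph V) [DecidableRel G.Adj] (L : V → Finset α) (w : V) (g : V → α)
    (h1 : ∀ x, x ≠ w → g x ∈ L x)
    (h2 : ∀ x y, x ≠ w → y ≠ w → G.Adj x y → g x ≠ g y)
    (c : α) (hc : c ∈ L w) (hc' : ∀ y, G.Adj w y → g y ≠ c) :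
    ∃ f : V → α, (∀ x : V, f x ∈ L x) ∧ ∀ x y : V, G.Adj x y → f x ≠ f y := by
  refine ⟨Function.update g w c, ?_, ?_⟩
  · intro x
    by_cases h : x = w
    · subst h; simpa using hc
    · rw [Function.update_of_ne h]; exact h1 x h
  · intro a b hab
    by_cases hax : a = w
    · subst hax
      have hba : b ≠ a := fun h => G.loopless.irrefl _ (h ▸ hab)
      rw [Function.update_self, Function.update_of_ne hba]
      exact (hc' b hab).symm
    · by_cases hbx : b = w
      · subst hbx
        rw [Function.update_self, Function.update_of_ne hax]
        exact (hc' a hab.symm)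
      · rw [Function.update_of_ne hax, Function.update_of_ne hbx]
        exact h2 a b hax hbx hab

/-- an unused color exists if the color of one neighbor `u` is irrelevant -/
lemma finish_one {V α : Type*} [Fintype V] [DecidableEq V] [DecidableEq α]
    (G : SimpleGraph V) [DecidableRel G.Adj] (L : V → Finset α)
    (hL : ∀ x : V, G.degree x ≤ (L x).card) (w : V) (g : V → α)
    (h1 : ∀ x, x ≠ w → g x ∈ L x)
    (h2 : ∀ x y, x ≠ w → y ≠ w → G.Adj x y → g x ≠ g y)
    (u : V) (hu : G.Adj w u) (h : g u ∉ L w ∨ ∃ b, b ≠ u ∧ G.Adj w b ∧ g b = g u) :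
    ∃ f : V → α, (∀ x : V, f x ∈ L x) ∧ ∀ x y : V, G.Adj x y → f x ≠ f y := by
  have hcard : (((G.neighborFinset w).erase u).image g).card < (L w).card := by
    refine lt_of_le_of_lt Finset.card_image_le ?_
    have : u ∈ G.neighborFinset w := by simpa using hu
    rw [Finset.card_erase_of_mem this]
    have h1 := hL w
    have h2 : 0 < (G.neighborFinset w).card := Finset.card_pos.2 ⟨_, this⟩
    rw [G.card_neighborFinset_eq_degree] at *
    omega
  obtain ⟨c, hc, hc'⟩ := Finset.exists_mem_notMem_of_card_lt_card hcard
  have key : ∀ y, y ≠ u → G.Adj w y → g y ≠ c := by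
    intro y hy hwy e
    exact hc' (Finset.mem_image.2 ⟨y, Finset.mem_erase.2 ⟨hy, by simpa using hwy⟩, e⟩)
  refine finish G L w g h1 h2 c hc ?_
  intro y hy
  by_cases hyu : y = u
  · subst hyu
    rcases h with h | ⟨b, hb, hwb, e⟩
    · intro e; exact h (e ▸ hc)
    · rw [← e]; exact key b hb hwb
  · exact key y hyu hy

lemma exists_rank {V : Type*} (G : SimpleGraph V) (hG : G.Connected) (w : V) :
    ∃ r : V → ℕ, ∀ x, x ≠ w → ∃ y, G.Adj x y ∧ r y < r x := by
  refine ⟨fun x => G.dist x w, fun x hx => ?_⟩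
  obtain ⟨p, hp⟩ := hG.exists_walk_length_eq_dist x w
  cases p with
  | nil => exact absurd rfl hx
  | cons h q =>
    refine ⟨_, h, ?_⟩
    have := SimpleGraph.dist_le q
    beta_reduce
    simp at hp
    omega

lemma exists_P3 {V : Type*} (G : SimpleGraph V) (hG : G.Connected)
    (hnc : ∃ a b, a ≠ b ∧ ¬ G.Adj a b) :
    ∃ x v y, G.Adj x v ∧ G.Adj v y ∧ x ≠ y ∧ ¬ G.Adj x y := by
  by_contra! hcon
  obtain ⟨a, b, hab, hn⟩ := hnc
  have : ∀ a b (p : G.Walk a b), a = b ∨ G.Adj a b := by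
    intro a b p
    induction p with
    | nil => left; rfl
    | @cons u v w h q ih =>
      rcases ih with rfl | ih
      · right; exact h
      · by_cases e : u = w
        · left; exact e
        · right; exact hcon _ _ _ h ih e
  obtain ⟨p⟩ := hG.preconnected a b
  rcases this a b p with h | h
  · exact hab h
  · exact hn h

lemma exists_long_path {V : Type*} [Fintype V] (G : SimpleGraph V) (x v y : V)
    (hxv : G.Adj x v) (hvy : G.Adj v y) (hxy : x ≠ y) :
    ∃ (n : ℕ) (p : ℕ → V), 3 ≤ n ∧ p 0 = x ∧ p 1 = v ∧ p 2 = y ∧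
      (∀ i j, i < n → j < n → p i = p j → i = j) ∧
      (∀ i, i + 1 < n → G.Adj (p i) (p (i + 1))) ∧
      (∀ u, G.Adj (p (n - 1)) u → ∃ i, i < n ∧ p i = u) := by
  classical
  let P : ℕ → Prop := fun n => ∃ p : ℕ → V, 3 ≤ n ∧ p 0 = x ∧ p 1 = v ∧ p 2 = y ∧
      (∀ i j, i < n → j < n → p i = p j → i = j) ∧
      (∀ i, i + 1 < n → G.Adj (p i) (p (i + 1)))
  have hb : ∀ n, P n → n ≤ Fintype.card V := by
    rintro n ⟨p, -, -, -, -, hinj, -⟩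
    have := Fintype.card_le_of_injective (fun i : Fin n => p i)
      (fun i j h => Fin.ext (hinj i j i.2 j.2 h))
    simpa using this
  have h3 : P 3 := by
    refine ⟨fun i => if i = 0 then x else if i = 1 then v else y, le_rfl, by simp, by simp,
      by simp, ?_, ?_⟩
    · intro i j hi hj h
      have h1 := hxv.ne
      have h2 := hvy.ne
      interval_cases i <;> interval_cases j <;> simp_all
    · intro i hi
      have : i = 0 ∨ i = 1 := by omega
      rcases this with rfl | rfl <;> simp [hxv, hvy]
  have hn := Nat.findGreatest_spec (P := P) (hb 3 h3) h3
  set n := Nat.findGreatest P (Fintype.card V) with hndef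
  obtain ⟨p, hn3, h0, h1, h2, hinj, hadj⟩ := hn
  refine ⟨n, p, hn3, h0, h1, h2, hinj, hadj, ?_⟩
  intro u hu
  by_contra! hcon
  have hP : P (n + 1) := by
    have hup : ∀ i, i < n → Function.update p n u i = p i := fun i hi =>
      Function.update_of_ne (by omega) _ _
    refine ⟨Function.update p n u, by omega, ?_, ?_, ?_, ?_, ?_⟩
    · rw [hup _ (by omega), h0]
    · rw [hup _ (by omega), h1]
    · rw [hup _ (by omega), h2]
    · intro i j hi hj h
      by_cases hi' : i = n
      · by_cases hj' : j = n
        · omega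
        · rw [hi', hup j (by omega), Function.update_self] at h
          exact absurd h.symm (hcon j (by omega))
      · by_cases hj' : j = n
        · rw [hj', hup i (by omega), Function.update_self] at h
          exact absurd h (hcon i (by omega))
        · rw [hup i (by omega), hup j (by omega)] at h
          exact hinj i j (by omega) (by omega) h
    · intro i hi
      by_cases hi' : i + 1 = n
      · rw [hup i (by omega), hi', Function.update_self]
        have : i = n - 1 := by omega
        rw [this]; exact hu
      · rw [hup i (by omega), hup (i + 1) (by omega)]
        exact hadj i (by omega)
  have := Nat.le_findGreatest (hb _ hP) hP
  omega

lemma exists_idx {V : Type*} (n : ℕ) (p : ℕ → V)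
    (hinj : ∀ i j, i < n → j < n → p i = p j → i = j) :
    ∃ idx : V → ℕ, ∀ i, i < n → idx (p i) = i := by
  classical
  refine ⟨fun v => if h : ∃ i, i < n ∧ p i = v then h.choose else 0, ?_⟩
  intro i hi
  have h : ∃ k, k < n ∧ p k = p i := ⟨i, hi, rfl⟩
  beta_reduce
  rw [dif_pos h]
  exact hinj _ _ h.choose_spec.1 hi h.choose_spec.2

lemma exists_boundary {V : Type*} (G : SimpleGraph V) (hG : G.Connected) (C : Set V)
    (a b : V) (ha : a ∈ C) (hb : b ∉ C) : ∃ x ∈ C, ∃ y ∉ C, G.Adj x y := by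
  by_contra! hcon
  have : ∀ a b (p : G.Walk a b), a ∈ C → b ∈ C := by
    intro a b p
    induction p with
    | nil => exact id
    | cons h q ih =>
      intro hu
      apply ih
      by_contra hv
      exact hcon _ hu _ hv h
  obtain ⟨p⟩ := hG.preconnected a b
  exact hb (this a b p ha)

lemma brooks_cycle {V α : Type*} [Fintype V] [DecidableEq V] [DecidableEq α]
    (G : SimpleGraph V) [DecidableRel G.Adj] (hG : G.Connected) (K : Finset α)
    (hK : ∀ x, G.degree x = K.card) (c0 : α)
    (n : ℕ) (p : ℕ → V) (hn : 3 ≤ n)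
    (hinj : ∀ i j, i < n → j < n → p i = p j → i = j)
    (hadj : ∀ i, i + 1 < n → G.Adj (p i) (p (i + 1)))
    (j : ℕ) (hjn : j + 2 < n) (hj : G.Adj (p (n - 1)) (p j))
    (hend : ∀ u, G.Adj (p (n - 1)) u → ∃ i, j ≤ i ∧ i < n ∧ p i = u)
    (z : V) (hz : ∀ i, j ≤ i → i < n → p i ≠ z) :
    ∃ f : V → α, (∀ x : V, f x ∈ K) ∧ ∀ x y : V, G.Adj x y → f x ≠ f y := by
  obtain ⟨idx, hidx⟩ := exists_idx n p hinj
  let C : Finset V := (Finset.Ico j n).image p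
  have hC : ∀ v, v ∈ C ↔ ∃ i, j ≤ i ∧ i < n ∧ p i = v := by
    intro v
    simp [C, and_assoc]
  obtain ⟨x, hx, y, hy, hxy⟩ := exists_boundary G hG (C : Set V) (p j) z
    ((hC _).2 ⟨j, le_rfl, by omega, rfl⟩)
    (fun h => by
      obtain ⟨i, h1, h2, h3⟩ := (hC z).1 h
      exact hz i h1 h2 h3)
  obtain ⟨k, hk1, hk2, rfl⟩ := (hC x).1 hx
  let Q : ℕ → Prop := fun i => j ≤ i ∧ i < n ∧ ∃ u ∉ C, G.Adj (p i) u
  have hQk : Q k := ⟨hk1, hk2, y, hy, hxy⟩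
  obtain ⟨i, hQi, hQi'⟩ : ∃ i, Q i ∧ ¬ Q (i + 1) := by
    by_contra! hcon
    have : ∀ m, Q (k + m) := by
      intro m
      induction m with
      | zero => exact hQk
      | succ m ih => exact hcon _ ih
    have := (this n).2.1
    omega
  obtain ⟨hji, hin, u, hu, hau⟩ := hQi
  have hin' : i + 1 < n := by
    by_contra h
    have : i = n - 1 := by omega
    subst this
    exact hu ((hC u).2 (hend u hau))
  have hb : ∀ u, G.Adj (p (i + 1)) u → u ∈ C := by
    intro u hu
    by_contra h
    exact hQi' ⟨by omega, hin', u, h, hu⟩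
  -- color everything except one vertex of C
  obtain ⟨r, hr⟩ := exists_rank G hG (p i)
  obtain ⟨g, -, hg1, hg2⟩ := greedy G (fun _ => K) (fun x => (hK x).le) (p i) r _ Finset.univ rfl
    (Finset.mem_univ _)
    (fun x _ hx => by
      obtain ⟨y, h1, h2⟩ := hr x hx
      exact ⟨y, Finset.mem_univ _, h1, h2⟩)
    (fun _ => c0) (by simp) (by simp)
  have hpi : p i ∈ C := (hC _).2 ⟨i, hji, hin, rfl⟩
  have hpb : p (i + 1) ∈ C := (hC _).2 ⟨i + 1, by omega, hin', rfl⟩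
  have hneC : ∀ v, v ∉ C → v ≠ p i := by
    rintro v hv rfl; exact hv hpi
  have hneCb : ∀ v, v ∉ C → v ≠ p (i + 1) := by
    rintro v hv rfl; exact hv hpb
  have hcase : ∀ v, v ∉ C.erase (p (i + 1)) → v = p (i + 1) ∨ (v ≠ p (i + 1) ∧ v ∉ C) := by
    intro v hv
    by_cases h : v = p (i + 1)
    · exact Or.inl h
    · exact Or.inr ⟨h, fun h' => hv (Finset.mem_erase.2 ⟨h, h'⟩)⟩
  obtain ⟨g', hg'0, hg'1, hg'2⟩ := greedy G (fun _ => K) (fun x => (hK x).le) (p i)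
    (fun v => if idx v ≤ i then i - idx v else i + n - idx v) _ (C.erase (p (i + 1))) rfl
    (Finset.mem_erase.2 ⟨(hadj i hin').ne, hpi⟩)
    (by
      intro v hv hvi
      rw [Finset.mem_erase, hC] at hv
      obtain ⟨hvb, k, hk1, hk2, rfl⟩ := hv
      have hki : k ≠ i := by rintro rfl; exact hvi rfl
      have hki' : k ≠ i + 1 := by rintro rfl; exact hvb rfl
      by_cases hkn : k = n - 1
      · subst hkn
        refine ⟨p j, ?_, hj, ?_⟩
        · rw [Finset.mem_erase, hC]
          refine ⟨?_, j, le_rfl, by omega, rfl⟩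
          intro h
          have := hinj _ _ (by omega) (by omega) h
          omega
        · rw [hidx _ hk2, hidx j (by omega), if_pos hji, if_neg (by omega)]
          omega
      · refine ⟨p (k + 1), ?_, hadj k (by omega), ?_⟩
        · rw [Finset.mem_erase, hC]
          refine ⟨?_, k + 1, by omega, by omega, rfl⟩
          intro h
          have := hinj _ _ (by omega) (by omega) h
          omega
        · rw [hidx _ hk2, hidx (k + 1) (by omega)]
          split_ifs <;> omega)
    (Function.update g (p (i + 1)) (g u))
    (by
      intro v hv
      rcases hcase v hv with rfl | ⟨h1, h2⟩
      · rw [Function.update_self]; exact hg1 u (hneC u hu)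
      · rw [Function.update_of_ne h1]; exact hg1 v (hneC v h2))
    (by
      intro v hv w hw hvw
      rcases hcase v hv with rfl | ⟨h1, h2⟩
      · rcases hcase w hw with rfl | ⟨h3, h4⟩
        · exact absurd rfl hvw.ne
        · exact absurd (hb _ hvw) h4
      · rcases hcase w hw with rfl | ⟨h3, h4⟩
        · exact absurd (hb _ hvw.symm) h2
        · rw [Function.update_of_ne h1, Function.update_of_ne h3]
          exact hg2 v w (hneC v h2) (hneC w h4) hvw)
  refine finish_one G (fun _ => K) (fun x => (hK x).le) (p i) g' hg'1 hg'2 u hau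
    (Or.inr ⟨p (i + 1), (hneCb u hu).symm, hadj i hin', ?_⟩)
  rw [hg'0 _ (by simp), hg'0 u (fun h => hu (Finset.mem_of_mem_erase h)),
    Function.update_self, Function.update_of_ne (hneCb u hu)]

lemma brooks_ham {V α : Type*} [Fintype V] [DecidableEq V] [DecidableEq α]
    (G : SimpleGraph V) [DecidableRel G.Adj] (K : Finset α)
    (hK : ∀ x, G.degree x = K.card) (hK3 : 3 ≤ K.card)
    (n : ℕ) (p : ℕ → V) (hn : 3 ≤ n)
    (hinj : ∀ i j, i < n → j < n → p i = p j → i = j)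
    (hadj : ∀ i, i + 1 < n → G.Adj (p i) (p (i + 1)))
    (hsurj : ∀ v, ∃ i, i < n ∧ p i = v)
    (h02 : ¬ G.Adj (p 0) (p 2)) :
    ∃ f : V → α, (∀ x : V, f x ∈ K) ∧ ∀ x y : V, G.Adj x y → f x ≠ f y := by
  obtain ⟨idx, hidx⟩ := exists_idx n p hinj
  have hne : ∀ i j, i < n → j < n → i ≠ j → p i ≠ p j := fun i j hi hj h e => h (hinj i j hi hj e)
  obtain ⟨m, hm3, hmn, hm⟩ : ∃ m, 3 ≤ m ∧ m < n ∧ G.Adj (p 1) (p m) := by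
    have hlt : ({p 0, p 2} : Finset V).card < (G.neighborFinset (p 1)).card := by
      rw [G.card_neighborFinset_eq_degree, hK]
      exact lt_of_le_of_lt Finset.card_le_two (by omega)
    obtain ⟨v, hv, hv'⟩ := Finset.exists_mem_notMem_of_card_lt_card hlt
    obtain ⟨m, hmn, rfl⟩ := hsurj v
    rw [SimpleGraph.mem_neighborFinset] at hv
    refine ⟨m, ?_, hmn, hv⟩
    by_contra h
    have : m = 0 ∨ m = 1 ∨ m = 2 := by omega
    rcases this with rfl | rfl | rfl
    · simp at hv'
    · exact hv.ne rfl
    · simp at hv'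
  obtain ⟨c, hc⟩ : K.Nonempty := Finset.card_pos.1 (by omega)
  have hcase : ∀ v, v ∉ ({p 0, p 2} : Finset V)ᶜ → v = p 0 ∨ v = p 2 := by
    intro v hv; simp at hv; tauto
  have hmem : ∀ k, k < n → k ≠ 0 → k ≠ 2 → p k ∈ ({p 0, p 2} : Finset V)ᶜ := by
    intro k hk h0 h2
    simp only [Finset.mem_compl, Finset.mem_insert, Finset.mem_singleton, not_or]
    exact ⟨hne _ _ hk (by omega) h0, hne _ _ hk (by omega) h2⟩
  obtain ⟨g', hg'0, hg'1, hg'2⟩ := greedy G (fun _ => K) (fun x => (hK x).le) (p 1)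
    (fun v => if idx v = 1 then 0 else if idx v ≤ m then m - idx v + 1 else idx v - m + 1)
    _ ({p 0, p 2}ᶜ) rfl
    (hmem 1 (by omega) (by omega) (by omega))
    (by
      intro v hv hv1
      obtain ⟨k, hk, rfl⟩ := hsurj v
      have hk0 : k ≠ 0 := by rintro rfl; simp at hv
      have hk2 : k ≠ 2 := by rintro rfl; simp at hv
      have hk1 : k ≠ 1 := by rintro rfl; exact hv1 rfl
      rcases lt_trichotomy k m with h | h | h
      · refine ⟨p (k + 1), hmem _ (by omega) (by omega) (by omega), hadj k (by omega), ?_⟩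
        rw [hidx _ hk, hidx _ (by omega : k + 1 < n)]
        split_ifs <;> omega
      · subst h
        refine ⟨p 1, hmem _ (by omega) (by omega) (by omega), hm.symm, ?_⟩
        rw [hidx _ hk, hidx _ (by omega : 1 < n)]
        split_ifs <;> omega
      · refine ⟨p (k - 1), hmem _ (by omega) (by omega) (by omega), ?_, ?_⟩
        · have := hadj (k - 1) (by omega)
          rw [Nat.sub_add_cancel (by omega)] at this
          exact this.symm
        · rw [hidx _ hk, hidx _ (by omega : k - 1 < n)]
          split_ifs <;> omega)
    (fun _ => c) (fun _ _ => hc)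
    (by
      intro v hv w hw hvw
      rcases hcase v hv with rfl | rfl <;> rcases hcase w hw with rfl | rfl
      · exact absurd rfl hvw.ne
      · exact absurd hvw h02
      · exact absurd hvw.symm h02
      · exact absurd rfl hvw.ne)
  refine finish_one G (fun _ => K) (fun x => (hK x).le) (p 1) g' hg'1 hg'2 (p 0)
    (hadj 0 (by omega)).symm
    (Or.inr ⟨p 2, hne _ _ (by omega) (by omega) (by omega), hadj 1 (by omega), ?_⟩)
  rw [hg'0 _ (by simp), hg'0 _ (by simp)]

lemma two_regular {V α : Type*} [Fintype V] [DecidableEq V] [DecidableEq α]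
    (G : SimpleGraph V) [DecidableRel G.Adj] (K : Finset α)
    (hK : ∀ x, G.degree x = K.card) (hK2 : K.card = 2)
    (n : ℕ) (p : ℕ → V) (hn : 3 ≤ n)
    (hinj : ∀ i j, i < n → j < n → p i = p j → i = j)
    (hadj : ∀ i, i + 1 < n → G.Adj (p i) (p (i + 1)))
    (hsurj : ∀ v, ∃ i, i < n ∧ p i = v)
    (hcl : G.Adj (p (n - 1)) (p 0))
    (hodd : ¬ ∃ n : ℕ, Odd n ∧ 3 ≤ n ∧ Nonempty (G ≃g SimpleGraph.cycleGraph n)) :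
    ∃ f : V → α, (∀ x : V, f x ∈ K) ∧ ∀ x y : V, G.Adj x y → f x ≠ f y := by
  obtain ⟨idx, hidx⟩ := exists_idx n p hinj
  have hne : ∀ i j, i < n → j < n → i ≠ j → p i ≠ p j := fun i j hi hj h e => h (hinj i j hi hj e)
  have key : ∀ i a b, a ≠ b → a < n → b < n → G.Adj (p i) (p a) → G.Adj (p i) (p b) →
      ∀ k, k < n → G.Adj (p i) (p k) → k = a ∨ k = b := by
    intro i a b hab ha hb h1 h2 k hk h3
    by_contra! hcon
    have hsub : ({p a, p b, p k} : Finset V) ⊆ G.neighborFinset (p i) := by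
      intro v
      simp only [Finset.mem_insert, Finset.mem_singleton, SimpleGraph.mem_neighborFinset]
      rintro (rfl | rfl | rfl) <;> assumption
    have h4 := Finset.card_le_card hsub
    rw [G.card_neighborFinset_eq_degree, hK, hK2, Finset.card_eq_three.2
      ⟨p a, p b, p k, hne _ _ ha hb hab, hne _ _ ha hk hcon.1.symm, hne _ _ hb hk hcon.2.symm, rfl⟩] at h4
    omega
  have hA : ∀ i k, i < n → k < n → (G.Adj (p i) (p k) ↔
      (k = i + 1 ∨ i = k + 1 ∨ (i = 0 ∧ k = n - 1) ∨ (k = 0 ∧ i = n - 1))) := by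
    intro i k hi hk
    constructor
    · intro h
      by_cases h0 : i = 0
      · subst h0
        have := key 0 1 (n - 1) (by omega) (by omega) (by omega) (hadj 0 (by omega)) hcl.symm k hk h
        omega
      · have hpred : G.Adj (p i) (p (i - 1)) := by
          have := hadj (i - 1) (by omega)
          rw [Nat.sub_add_cancel (by omega)] at this
          exact this.symm
        by_cases hl : i = n - 1
        · have := key i 0 (i - 1) (by omega) (by omega) (by omega) (hl ▸ hcl) hpred k hk h
          omega
        · have := key i (i + 1) (i - 1) (by omega) (by omega) (by omega) (hadj i (by omega))
            hpred k hk h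
          omega
    · rintro (rfl | rfl | ⟨rfl, rfl⟩ | ⟨rfl, rfl⟩)
      · exact hadj _ hk
      · exact (hadj _ hi).symm
      · exact hcl.symm
      · exact hcl
  rcases Nat.even_or_odd n with he | ho
  · obtain ⟨c1, c2, hc, rfl⟩ := Finset.card_eq_two.1 hK2
    refine ⟨fun v => if idx v % 2 = 0 then c1 else c2, ?_, ?_⟩
    · intro x; beta_reduce; split_ifs <;> simp
    · intro x y hxy
      obtain ⟨i, hi, rfl⟩ := hsurj x
      obtain ⟨k, hk, rfl⟩ := hsurj y
      rw [hA i k hi hk] at hxy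
      beta_reduce
      rw [hidx i hi, hidx k hk]
      obtain ⟨t, ht⟩ := he
      split_ifs
      · omega
      · exact hc
      · exact hc.symm
      · omega
  · exfalso
    apply hodd
    refine ⟨n, ho, hn, ⟨RelIso.symm ⟨Equiv.ofBijective (fun i : Fin n => p i) ⟨?_, ?_⟩, ?_⟩⟩⟩
    · intro i j h; exact Fin.ext (hinj _ _ i.2 j.2 h)
    · intro v
      obtain ⟨i, hi, rfl⟩ := hsurj v
      exact ⟨⟨i, hi⟩, rfl⟩
    · intro i k
      rw [SimpleGraph.cycleGraph_adj']
      refine (hA i k i.2 k.2).trans ?_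
      have hi := i.2
      have hk := k.2
      rw [Fin.sub_def, Fin.sub_def]
      simp only
      generalize (i : ℕ) = a at *
      generalize (k : ℕ) = b at *
      rcases lt_trichotomy a b with h | h | h
      · have e1 : (n - b + a) % n = n - b + a := Nat.mod_eq_of_lt (by omega)
        have e2 : (n - a + b) % n = b - a := by
          rw [show n - a + b = (b - a) + n by omega, Nat.add_mod_right, Nat.mod_eq_of_lt (by omega)]
        rw [e1, e2]; omega
      · subst h
        rw [show n - a + a = n by omega, Nat.mod_self]; omega
      · have e1 : (n - a + b) % n = n - a + b := Nat.mod_eq_of_lt (by omega)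
        have e2 : (n - b + a) % n = a - b := by
          rw [show n - b + a = (a - b) + n by omega, Nat.add_mod_right, Nat.mod_eq_of_lt (by omega)]
        rw [e1, e2]; omega

lemma brooks_s8 {V α : Type*} [Fintype V] [DecidableEq V] [DecidableEq α]
    (G : SimpleGraph V) [DecidableRel G.Adj] (hG : G.Connected) (K : Finset α)
    (hK : ∀ x, G.degree x = K.card)
    (hnc : ∃ a b, a ≠ b ∧ ¬ G.Adj a b)
    (hodd : ¬ ∃ n : ℕ, Odd n ∧ 3 ≤ n ∧ Nonempty (G ≃g SimpleGraph.cycleGraph n)) :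
    ∃ f : V → α, (∀ x : V, f x ∈ K) ∧ ∀ x y : V, G.Adj x y → f x ≠ f y := by
  obtain ⟨x, v, y, hxv, hvy, hxy, hnxy⟩ := exists_P3 G hG hnc
  have hK2 : 2 ≤ K.card := by
    rw [← hK v, ← G.card_neighborFinset_eq_degree, ← Finset.card_pair hxy]
    apply Finset.card_le_card
    intro u
    simp only [Finset.mem_insert, Finset.mem_singleton, SimpleGraph.mem_neighborFinset]
    rintro (rfl | rfl)
    · exact hxv.symm
    · exact hvy
  obtain ⟨c0, hc0⟩ : K.Nonempty := Finset.card_pos.1 (by omega)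
  obtain ⟨n, p, hn, h0, h1, h2, hinj, hadj, hend⟩ := exists_long_path G x v y hxv hvy hxy
  subst h0 h1 h2
  -- least neighbor index
  have hex : ∃ j, j < n ∧ G.Adj (p (n - 1)) (p j) := by
    refine ⟨n - 2, by omega, ?_⟩
    have := hadj (n - 2) (by omega)
    rw [show n - 2 + 1 = n - 1 by omega] at this
    exact this.symm
  classical
  obtain ⟨hjn, hj⟩ := Nat.find_spec hex
  have hmin := fun m (h : m < n ∧ G.Adj (p (n - 1)) (p m)) => Nat.find_min' hex h
  generalize Nat.find hex = j at *
  have hjn2 : j + 2 < n := by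
    by_contra hcon
    have hlt : ({p (n - 2)} : Finset V).card < (G.neighborFinset (p (n - 1))).card := by
      rw [G.card_neighborFinset_eq_degree, hK, Finset.card_singleton]; omega
    obtain ⟨u, hu, hu'⟩ := Finset.exists_mem_notMem_of_card_lt_card hlt
    rw [SimpleGraph.mem_neighborFinset] at hu
    obtain ⟨i, hi, rfl⟩ := hend u hu
    have := hmin i ⟨hi, hu⟩
    have h1 : i ≠ n - 1 := by rintro rfl; exact hu.ne rfl
    have h2 : i ≠ n - 2 := by rintro rfl; simp at hu'
    omega
  by_cases hz : ∃ z, ∀ i, j ≤ i → i < n → p i ≠ z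
  · obtain ⟨z, hz⟩ := hz
    refine brooks_cycle G hG K hK c0 n p hn hinj hadj j hjn2 hj ?_ z hz
    intro u hu
    obtain ⟨i, hi, rfl⟩ := hend u hu
    exact ⟨i, hmin i ⟨hi, hu⟩, hi, rfl⟩
  · push Not at hz
    have hj0 : j = 0 := by
      obtain ⟨i, h1, h2, h3⟩ := hz (p 0)
      have := hinj i 0 h2 (by omega) h3
      omega
    subst hj0
    have hsurj : ∀ v, ∃ i, i < n ∧ p i = v := fun v => by
      obtain ⟨i, h1, h2, h3⟩ := hz v
      exact ⟨i, h2, h3⟩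
    by_cases h3 : 3 ≤ K.card
    · exact brooks_ham G K hK h3 n p hn hinj hadj hsurj hnxy
    · exact two_regular G K hK (by omega) n p hn hinj hadj hsurj hj hodd

lemma main_block {V α : Type*} [Fintype V] [DecidableEq V] [DecidableEq α]
    (G : SimpleGraph V) [DecidableRel G.Adj] (hG : G.Connected)
    (hcut : ∀ v, (G.induce {v}ᶜ).Connected)
    (hnc : ∃ a b, a ≠ b ∧ ¬ G.Adj a b)
    (hodd : ¬ ∃ n : ℕ, Odd n ∧ 3 ≤ n ∧ Nonempty (G ≃g SimpleGraph.cycleGraph n))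
    (L : V → Finset α) (hL : ∀ x : V, G.degree x ≤ (L x).card) :
    ∃ f : V → α, (∀ x : V, f x ∈ L x) ∧ ∀ x y : V, G.Adj x y → f x ≠ f y := by
  obtain ⟨x0, v0, y0, hxv0, -⟩ := exists_P3 G hG hnc
  obtain ⟨c0, -⟩ : (L x0).Nonempty := Finset.card_pos.1
    (lt_of_lt_of_le ((G.degree_pos_iff_exists_adj x0).2 ⟨_, hxv0⟩) (hL x0))
  by_contra hno
  -- degrees equal list sizes
  have hdeg : ∀ x, G.degree x = (L x).card := by
    intro w
    by_contra hw
    have hlt := lt_of_le_of_ne (hL w) hw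
    obtain ⟨r, hr⟩ := exists_rank G hG w
    obtain ⟨g, -, hg1, hg2⟩ := greedy G L hL w r _ Finset.univ rfl
      (Finset.mem_univ _)
      (fun x _ hx => by
        obtain ⟨y, h1, h2⟩ := hr x hx
        exact ⟨y, Finset.mem_univ _, h1, h2⟩)
      (fun _ => c0) (by simp) (by simp)
    have hcard : ((G.neighborFinset w).image g).card < (L w).card := by
      refine lt_of_le_of_lt Finset.card_image_le ?_
      rwa [G.card_neighborFinset_eq_degree]
    obtain ⟨c, hc, hc'⟩ := Finset.exists_mem_notMem_of_card_lt_card hcard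
    exact hno (finish G L w g hg1 hg2 c hc
      (fun y hy e => hc' (Finset.mem_image.2 ⟨y, by simpa using hy, e⟩)))
  have hsub : ∀ v u, G.Adj v u → L v ⊆ L u := by
    intro v u hvu c hc
    by_contra hcu
    obtain ⟨r, hr⟩ := exists_rank _ (hcut v) ⟨u, by simpa using hvu.ne'⟩
    obtain ⟨g, hg0, hg1, hg2⟩ := greedy G L hL u
      (fun x => if h : x ≠ v then r ⟨x, by simpa using h⟩ else 0) _ ({v}ᶜ) rfl
      (by simpa using hvu.ne')
      (by
        intro x hx hxu
        have hxv : x ≠ v := by simpa using hx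
        obtain ⟨⟨y, hy⟩, h1, h2⟩ := hr ⟨x, by simpa using hxv⟩ (by simpa using hxu)
        have hyv : y ≠ v := by simpa using hy
        refine ⟨y, by simpa using hyv, by simpa using h1, ?_⟩
        rw [dif_pos hyv, dif_pos hxv]
        exact h2)
      (fun _ => c)
      (by
        intro x hx
        have : x = v := by simpa using hx
        subst this; exact hc)
      (by
        intro x hx y hy hxy
        have h1 : x = v := by simpa using hx
        have h2 : y = v := by simpa using hy
        subst h1 h2
        exact absurd rfl hxy.ne)
    refine hno (finish_one G L hL u g hg1 hg2 v hvu.symm (Or.inl ?_))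
    rw [hg0 v (by simp)]
    exact hcu
  have heq : ∀ a b (p : G.Walk a b), L a = L b := by
    intro a b p
    induction p with
    | nil => rfl
    | cons h q ih => rw [← ih]; exact Finset.Subset.antisymm (hsub _ _ h) (hsub _ _ h.symm)
  have hall : ∀ x, L x = L x0 := fun x => by
    obtain ⟨p⟩ := hG.preconnected x x0
    exact heq _ _ p
  obtain ⟨f, hf1, hf2⟩ := brooks_s8 G hG (L x0) (fun x => by rw [hdeg, hall]) hnc hodd
  exact hno ⟨f, fun x => by rw [hall x]; exact hf1 x, hf2⟩

theorem list_degree_colorable {V α : Type*} [Fintype V] [DecidableEq α]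
    (G : SimpleGraph V) [DecidableRel G.Adj]
    (hconn : G.Connected) (hG : ¬ IsGallaiTree G)
    (L : V → Finset α) (hL : ∀ x : V, G.degree x ≤ (L x).card) :
    ∃ f : V → α, (∀ x : V, f x ∈ L x) ∧ ∀ x y : V, G.Adj x y → f x ≠ f y := by
  classical
  unfold IsGallaiTree at hG
  push Not at hG
  obtain ⟨B, ⟨hBc, hBn, -⟩, hncl, hnodd⟩ := hG
  have hncl' : ∃ a b : B, a ≠ b ∧ ¬ (G.induce B).Adj a b := by
    by_contra! hcon
    apply hncl
    intro a ha b hb hab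
    simpa using hcon ⟨a, ha⟩ ⟨b, hb⟩ (by simpa using hab)
  obtain ⟨a, b, hab, -⟩ := id hncl'
  obtain ⟨x0, v0, y0, hxv0, -⟩ := exists_P3 _ hBc hncl'
  obtain ⟨c0, -⟩ : (L x0).Nonempty := Finset.card_pos.1
    (lt_of_lt_of_le ((G.degree_pos_iff_exists_adj x0).2 ⟨v0, by simpa using hxv0⟩) (hL x0))
  obtain ⟨r, hr⟩ := exists_rank G hconn (a : V)
  obtain ⟨g, -, hg1, hg2⟩ := greedy G L hL a r _ Finset.univ rfl
    (Finset.mem_univ _)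
    (fun x _ hx => by
      obtain ⟨y, h1, h2⟩ := hr x hx
      exact ⟨y, Finset.mem_univ _, h1, h2⟩)
    (fun _ => c0) (by simp) (by simp)
  have hne : ∀ x, x ∉ B → x ≠ (a : V) := by
    rintro x hx rfl; exact hx a.2
  obtain ⟨f, hf1, hf2⟩ := main_block (G.induce B) hBc
    (by
      rintro ⟨v, hv⟩
      rcases hBn v hv with h | h
      · exfalso
        apply hab
        have h1 : (a : V) = v := Set.mem_singleton_iff.1 (h.subset a.2)
        have h2 : (b : V) = v := Set.mem_singleton_iff.1 (h.subset b.2)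
        exact Subtype.ext (h1.trans h2.symm)
      · refine h.map (⟨fun x => ⟨⟨x.1, x.2.1⟩, ?_⟩, ?_⟩ :
          G.induce (B \ {v}) →g (G.induce B).induce {⟨v, hv⟩}ᶜ) ?_
        · have := x.2.2
          simpa using this
        · intro x y hxy
          simpa using hxy
        · rintro ⟨⟨x, hx⟩, hx'⟩
          refine ⟨⟨x, hx, by simpa using hx'⟩, rfl⟩)
    hncl' hnodd
    (fun x => L x \ ((G.neighborFinset x).filter (fun y => y ∉ B)).image g)
    (by
      rintro ⟨x, hx⟩
      have h1 := hL x
      rw [← G.card_neighborFinset_eq_degree] at h1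
      have h2 := Finset.card_filter_add_card_filter_not (s := G.neighborFinset x) (fun y => y ∈ B)
      have h3 : ((G.induce B).degree ⟨x, hx⟩) ≤ ((G.neighborFinset x).filter (fun y => y ∈ B)).card := by
        rw [← SimpleGraph.card_neighborFinset_eq_degree]
        refine Finset.card_le_card_of_injOn (fun y => (y : V)) ?_ (Subtype.val_injective.injOn)
        intro y hy
        simpa using hy
      have h4 := Finset.le_card_sdiff (((G.neighborFinset x).filter (fun y => y ∉ B)).image g) (L x)
      have h5 := Finset.card_image_le (s := (G.neighborFinset x).filter (fun y => y ∉ B)) (f := g)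
      change _ ≤ (L x \ ((G.neighborFinset x).filter (fun y => y ∉ B)).image g).card
      omega)
  have hout : ∀ x (hx : x ∈ B) y, y ∉ B → G.Adj x y → f ⟨x, hx⟩ ≠ g y := by
    intro x hx y hy hxy e
    have := (Finset.mem_sdiff.1 (hf1 ⟨x, hx⟩)).2
    apply this
    rw [e]
    exact Finset.mem_image.2 ⟨y, by simp [hxy, hy], rfl⟩
  refine ⟨fun x => if h : x ∈ B then f ⟨x, h⟩ else g x, ?_, ?_⟩
  · intro x
    beta_reduce
    split_ifs with h
    · exact (Finset.mem_sdiff.1 (hf1 ⟨x, h⟩)).1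
    · exact hg1 x (hne x h)
  · intro x y hxy
    beta_reduce
    split_ifs with h1 h2 h2
    · exact hf2 _ _ (by simpa using hxy)
    · exact hout x h1 y h2 hxy
    · exact (hout y h2 x h1 hxy.symm).symm
    · exact hg2 x y (hne x h1) (hne y h2) hxy
end

section
/- Let G be a connected finite simple graph with maximum degree Δ. If G is neither a complete graph nor an odd cycle, then G is list Δ-colorable: for every assignment of lists L(v) of colors to the vertices with |L(v)| ≥ Δ for every vertex v, there exists a proper coloring of G in which each vertex v receives a color from its list L(v). -/
open Classical in
def GoodOn {V α : Type*} (G : SimpleGraph V) (L : V → Finset α) (S : Finset V) (f : V → α) : Prop :=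
  (∀ x ∈ S, f x ∈ L x) ∧ ∀ x ∈ S, ∀ y ∈ S, G.Adj x y → f x ≠ f y

open Classical in
theorem GoodOn.ins {V α : Type*} {G : SimpleGraph V} {L : V → Finset α} {S : Finset V} {f : V → α}
    (h : GoodOn G L S f) {v : V} {c : α} (hv : v ∉ S) (hc : c ∈ L v)
    (hn : ∀ u ∈ S, G.Adj v u → f u ≠ c) :
    GoodOn G L (insert v S) (Function.update f v c) := by
  have hne : ∀ x ∈ S, x ≠ v := fun x hx e => hv (e ▸ hx)
  constructor
  · intro x hx
    rcases Finset.mem_insert.1 hx with rfl | hx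
    · simpa using hc
    · rw [Function.update_of_ne (hne x hx)]; exact h.1 x hx
  · intro x hx y hy hxy
    rcases Finset.mem_insert.1 hx with rfl | hx' <;> rcases Finset.mem_insert.1 hy with rfl | hy'
    · exact absurd hxy (G.loopless.irrefl _)
    · rw [Function.update_self, Function.update_of_ne (hne y hy')]
      exact (hn y hy' hxy).symm
    · rw [Function.update_self, Function.update_of_ne (hne x hx')]
      exact (hn x hx' hxy.symm)
    · rw [Function.update_of_ne (hne x hx'), Function.update_of_ne (hne y hy')]
      exact h.2 x hx' y hy' hxy

open Classical in
theorem free_color {V α : Type*} [Fintype V] (G : SimpleGraph V) [DecidableRel G.Adj]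
    (L : V → Finset α) (hdeg : ∀ v, G.degree v ≤ (L v).card) (v u : V) (huv : G.Adj v u)
    (f : V → α) : ∃ c ∈ L v, ∀ x, G.Adj v x → x ≠ u → f x ≠ c := by
  by_contra! hcon
  have hsub : L v ⊆ ((G.neighborFinset v).erase u).image f := by
    intro c hc
    obtain ⟨x, hx, hxu, e⟩ := hcon c hc
    exact Finset.mem_image.2 ⟨x, by simp [hx, hxu], e⟩
  have h1 := Finset.card_le_card hsub
  have h2 : (((G.neighborFinset v).erase u).image f).card ≤ _ := Finset.card_image_le
  have h3 : ((G.neighborFinset v).erase u).card < (G.neighborFinset v).card :=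
    Finset.card_erase_lt_of_mem (by simpa using huv)
  have h4 := hdeg v
  rw [← G.card_neighborFinset_eq_degree] at h4
  omega

open Classical in
theorem ext_color {V α : Type*} [Fintype V] (G : SimpleGraph V) [DecidableRel G.Adj]
    (L : V → Finset α) (hdeg : ∀ v, G.degree v ≤ (L v).card) (P : Finset V) (f : V → α)
    (hf : GoodOn G L P f) (n : ℕ) : ∀ W : Finset V, W.card = n → Disjoint W P →
    (∀ W' ⊆ W, W'.Nonempty → ∃ v ∈ W', ∃ u, G.Adj v u ∧ u ∉ P ∧ u ∉ W') →
    ∃ f', GoodOn G L (W ∪ P) f' ∧ ∀ x ∈ P, f' x = f x := by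
  induction n with
  | zero =>
    intro W hW _ _
    rw [Finset.card_eq_zero] at hW
    subst hW
    exact ⟨f, by simpa using hf, fun _ _ => rfl⟩
  | succ n ih =>
    intro W hW hd hcl
    obtain ⟨v, hv, u, hvu, huP, huW⟩ := hcl W subset_rfl (Finset.card_pos.1 (by omega))
    have hvP : v ∉ P := Finset.disjoint_left.1 hd hv
    obtain ⟨f', hf', he⟩ := ih (W.erase v) (by rw [Finset.card_erase_of_mem hv]; omega)
      (hd.mono_left (Finset.erase_subset _ _))
      (fun W' h h' => hcl W' (h.trans (Finset.erase_subset _ _)) h')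
    obtain ⟨c, hc, hfree⟩ := free_color G L hdeg v u hvu f'
    refine ⟨Function.update f' v c, ?_, ?_⟩
    · have := hf'.ins (v := v) (c := c) (by simp [hvP]) hc (by
        intro x hx hvx
        apply hfree x hvx
        rintro rfl
        simp [huP, huW] at hx)
      rwa [← Finset.insert_union, Finset.insert_erase hv] at this
    · intro x hx
      rw [Function.update_of_ne (fun e => hvP (by rw [← e]; exact hx))]
      exact he x hx

open Classical in
/-- everything except `t`. -/
theorem ext_color' {V α : Type*} [Fintype V] (G : SimpleGraph V) [DecidableRel G.Adj]
    (L : V → Finset α) (hdeg : ∀ v, G.degree v ≤ (L v).card) (P : Finset V) (f : V → α)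
    (hf : GoodOn G L P f) (t : V) (ht : t ∉ P)
    (hcl : ∀ W : V → Prop, (∀ v, W v → ∀ u, G.Adj v u → u ∉ P → W u) →
      (∀ v, W v → v ∉ P) → (∃ v, W v) → W t) :
    ∃ f', GoodOn G L (Finset.univ.erase t) f' ∧ ∀ x ∈ P, f' x = f x := by
  obtain ⟨f', h1, h2⟩ := ext_color G L hdeg P f hf _ ((Finset.univ \ P).erase t) rfl
    (by
      rw [Finset.disjoint_left]
      intro x hx
      simp at hx
      exact hx.2) (by
      intro W' hW' hne
      by_contra! hcon
      have := hW' (hcl (· ∈ W') hcon (fun v hv => by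
        have := hW' hv
        simp at this
        exact this.2) hne)
      simp at this)
  refine ⟨f', ?_, h2⟩
  convert h1 using 1
  ext x
  simp
  by_cases hx : x = t
  · subst hx; simp [ht]
  · simp [hx]
    tauto

theorem last_color {V α : Type*} [Fintype V] (G : SimpleGraph V) 
    (L : V → Finset α) [DecidableEq V] (f : V → α) (t : V)
    (hf : GoodOn G L (Finset.univ.erase t) f)
    (c : α) (hc : c ∈ L t) (h : ∀ x, G.Adj t x → f x ≠ c) :
    ∃ f : V → α, (∀ x : V, f x ∈ L x) ∧ ∀ x y : V, G.Adj x y → f x ≠ f y := by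
  have h1 := hf.ins (v := t) (c := c) (by simp) hc (fun u _ => h u)
  refine ⟨_, fun x => h1.1 x ?_, fun x y => h1.2 x ?_ y ?_⟩ <;>
  · simp only [Finset.mem_insert, Finset.mem_erase, Finset.mem_univ, and_true]
    tauto

open Classical in
theorem finish_color {V α : Type*} [Fintype V] (G : SimpleGraph V) [DecidableRel G.Adj]
    (L : V → Finset α) (hdeg : ∀ v, G.degree v ≤ (L v).card) (P : Finset V) (f : V → α)
    (hf : GoodOn G L P f) (t : V) (ht : t ∉ P)
    (hcl : ∀ W : V → Prop, (∀ v, W v → ∀ u, G.Adj v u → u ∉ P → W u) →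
      (∀ v, W v → v ∉ P) → (∃ v, W v) → W t)
    (u : V) (huP : u ∈ P) (htu : G.Adj t u)
    (hs : f u ∉ L t ∨ ∃ w ∈ P, w ≠ u ∧ G.Adj t w ∧ f u = f w) :
    ∃ f : V → α, (∀ x : V, f x ∈ L x) ∧ ∀ x y : V, G.Adj x y → f x ≠ f y := by
  obtain ⟨f', h1, h2⟩ := ext_color' G L hdeg P f hf t ht hcl
  obtain ⟨c, hc, hfree⟩ := free_color G L hdeg t u htu f'
  refine last_color G L f' t h1 c hc fun x hx => ?_
  by_cases hxu : x = u
  · subst hxu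
    rw [h2 x huP]
    rcases hs with hs | ⟨w, hwP, hwu, htw, e⟩
    · rintro rfl; exact hs hc
    · rw [e, ← h2 w hwP]; exact hfree w htw hwu
  · exact hfree x hx hxu

/-- cycle lemma: `p j, ..., p r` is a cycle. -/
theorem cyc_color {V α : Type*} [Fintype V] (G : SimpleGraph V) [DecidableRel G.Adj]
    (L : V → Finset α) (hdeg : ∀ v, G.degree v ≤ (L v).card) (P : Finset V) (f : V → α)
    (hf : GoodOn G L P f) (p : ℕ → V) (r j k : ℕ) (hjk : j ≤ k) (hkr : k < r)
    (hadj : ∀ i < r, G.Adj (p i) (p (i+1))) (hrj : G.Adj (p r) (p j))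
    (hP : ∀ x, x ∈ P ∨ ∃ i, j ≤ i ∧ i ≤ r ∧ x = p i)
    (hP' : ∀ i, j ≤ i → i ≤ r → i ≠ k + 1 → p i ∉ P) (hP'' : p (k+1) ∈ P)
    (u : V) (huP : u ∈ P) (htu : G.Adj (p k) u)
    (hs : f u ∉ L (p k) ∨ ∃ w ∈ P, w ≠ u ∧ G.Adj (p k) w ∧ f u = f w) :
    ∃ f : V → α, (∀ x : V, f x ∈ L x) ∧ ∀ x y : V, G.Adj x y → f x ≠ f y := by
  refine finish_color G L hdeg P f hf (p k) (hP' k hjk hkr.le (by omega)) ?_ u huP htu hs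
  intro W hW hWP ⟨v, hv⟩
  have up : ∀ i l, W (p i) → j ≤ i → i + l ≤ r → (i + l ≤ k ∨ k + 1 < i) → W (p (i + l)) := by
    intro i l hi hji
    induction l with
    | zero => intros; exact hi
    | succ l ih =>
      intro h1 h2
      exact hW _ (ih (by omega) (by omega)) _ (hadj (i+l) (by omega))
        (hP' _ (by omega) (by omega) (by omega))
  obtain h | ⟨i, hji, hir, rfl⟩ := hP v
  · exact absurd h (hWP v hv)
  rcases Nat.lt_or_ge k i with hki | hki
  · have hne : i ≠ k + 1 := by rintro rfl; exact hWP _ hv hP''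
    have h1 := up i (r - i) hv hji (by omega) (by omega)
    rw [show i + (r - i) = r by omega] at h1
    have h2 := hW _ h1 _ hrj (hP' _ le_rfl (by omega) (by omega))
    have h3 := up j (k - j) h2 le_rfl (by omega) (by omega)
    rwa [show j + (k - j) = k by omega] at h3
  · have h3 := up i (k - i) hv hji (by omega) (by omega)
    rwa [show i + (k - i) = k by omega] at h3

theorem exists_cherry {V : Type*} (G : SimpleGraph V) (hconn : G.Connected) (h : G ≠ ⊤) :
    ∃ a b c, G.Adj a b ∧ G.Adj b c ∧ a ≠ c ∧ ¬ G.Adj a c := by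
  by_contra! hcon
  apply h
  ext x y
  rw [SimpleGraph.top_adj]
  refine ⟨fun h => h.ne, fun hxy => ?_⟩
  obtain ⟨w⟩ := hconn.preconnected x y
  induction w with
  | nil => exact absurd rfl hxy
  | @cons a b c hab w ih =>
    by_cases hbc : b = c
    · subst hbc; exact hab
    · exact hcon a b c hab (ih hbc) hxy

theorem exists_long {V : Type*} [Fintype V] (G : SimpleGraph V) (a b c : V) (hab : G.Adj a b)
    (hbc : G.Adj b c) (hac : a ≠ c) : ∃ (p : ℕ → V) (r : ℕ), 2 ≤ r ∧ p 0 = a ∧ p 1 = b ∧ p 2 = c ∧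
      (∀ i < r, G.Adj (p i) (p (i+1))) ∧ (∀ i l, i ≤ r → l ≤ r → p i = p l → i = l) ∧
      ∀ u, G.Adj (p r) u → ∃ i ≤ r, u = p i := by
  classical
  let Q : ℕ → Prop := fun r => 2 ≤ r ∧ ∃ p : ℕ → V, p 0 = a ∧ p 1 = b ∧ p 2 = c ∧
      (∀ i < r, G.Adj (p i) (p (i+1))) ∧ (∀ i l, i ≤ r → l ≤ r → p i = p l → i = l)
  have hb : ∀ r, Q r → r ≤ Fintype.card V := by
    rintro r ⟨-, p, -, -, -, -, hinj⟩
    have := Fintype.card_le_of_injective (fun i : Fin (r+1) => p i) (by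
      intro i l h
      exact Fin.ext (hinj i l (by omega) (by omega) h))
    simp at this
    omega
  have h2 : Q 2 := by
    refine ⟨le_rfl, fun i => if i = 0 then a else if i = 1 then b else c, by simp, by simp,
      by simp, ?_, ?_⟩
    · intro i hi
      interval_cases i
      · simpa using hab
      · simpa using hbc
    · have := hab.ne
      have := hbc.ne
      intro i l hi hl
      interval_cases i <;> interval_cases l <;> simp <;> grind
  have hspec := Nat.findGreatest_spec (hb 2 h2) h2
  have hmax : ∀ r, Q r → r ≤ Nat.findGreatest Q (Fintype.card V) := fun r hr =>
    Nat.le_findGreatest (hb r hr) hr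
  generalize Nat.findGreatest Q (Fintype.card V) = r at *
  obtain ⟨hr, p, p0, p1, p2, hadj, hinj⟩ := hspec
  refine ⟨p, r, hr, p0, p1, p2, hadj, hinj, ?_⟩
  intro u hu
  by_contra! hcon
  have := hmax (r+1) ⟨by omega, Function.update p (r+1) u, ?_, ?_, ?_, ?_, ?_⟩
  · omega
  · rw [Function.update_of_ne (by omega)]; exact p0
  · rw [Function.update_of_ne (by omega)]; exact p1
  · rw [Function.update_of_ne (by omega)]; exact p2
  · intro i hi
    rw [Function.update_of_ne (by omega)]
    by_cases h : i = r
    · subst h; simpa using hu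
    · rw [Function.update_of_ne (by omega)]; exact hadj i (by omega)
  · intro i l hi hl h
    by_cases h1 : i = r + 1 <;> by_cases h2 : l = r + 1
    · omega
    · subst h1
      rw [Function.update_self, Function.update_of_ne h2] at h
      exact absurd h (hcon l (by omega))
    · subst h2
      rw [Function.update_self, Function.update_of_ne h1] at h
      exact absurd h.symm (hcon i (by omega))
    · rw [Function.update_of_ne h1, Function.update_of_ne h2] at h
      exact hinj i l (by omega) (by omega) h

/-- a proper nonempty closed set does not exist -/
theorem conn_closed {V : Type*} (G : SimpleGraph V) (hconn : G.Connected) (W : V → Prop)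
    (hW : ∀ v, W v → ∀ u, G.Adj v u → W u) (x : V) (hx : W x) (y : V) : W y := by
  obtain ⟨w⟩ := hconn.preconnected x y
  induction w with
  | nil => exact hx
  | cons h w ih => exact ih (hW _ hx _ h)

/-- non-regular case -/
theorem nonreg_color {V α : Type*} [Fintype V] (G : SimpleGraph V) [DecidableRel G.Adj]
    (hconn : G.Connected)
    (L : V → Finset α) (hdeg : ∀ v, G.degree v ≤ (L v).card) (t : V)
    (ht : G.degree t < (L t).card) :
    ∃ f : V → α, (∀ x : V, f x ∈ L x) ∧ ∀ x y : V, G.Adj x y → f x ≠ f y := by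
  classical
  obtain ⟨c0, -⟩ := Finset.card_pos.1 (by omega : 0 < (L t).card)
  obtain ⟨f, hf, -⟩ := ext_color' G L hdeg ∅ (fun _ => c0) ⟨by simp, by simp⟩ t (by simp) (by
    intro W hW _ ⟨v, hv⟩
    exact conn_closed G hconn W (fun v hv u h => hW v hv u h (by simp)) v hv t)
  have : ∃ c ∈ L t, c ∉ (G.neighborFinset t).image f := by
    apply Finset.exists_mem_notMem_of_card_lt_card
    exact lt_of_le_of_lt Finset.card_image_le (by simpa using ht)
  obtain ⟨c, hc, hc'⟩ := this
  refine last_color G L f t hf c hc fun x hx e => hc' ?_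
  exact Finset.mem_image.2 ⟨x, by simpa using hx, e⟩

theorem cyc_iso {V : Type*} [Fintype V] (G : SimpleGraph V) [DecidableRel G.Adj]
    (hreg : ∀ v, G.degree v = 2) (p : ℕ → V) (r : ℕ) (hr : 2 ≤ r)
    (hadj : ∀ i < r, G.Adj (p i) (p (i+1))) (hinj : ∀ i l, i ≤ r → l ≤ r → p i = p l → i = l)
    (hsurj : ∀ x, ∃ i ≤ r, x = p i) (hr0 : G.Adj (p r) (p 0)) :
    Nonempty (G ≃g SimpleGraph.cycleGraph (r+1)) := by
  classical
  obtain ⟨n, rfl⟩ : ∃ n, r = n + 2 := ⟨r - 2, by omega⟩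
  let e : Fin (n+3) ≃ V := Equiv.ofBijective (fun i => p i) ⟨by
      intro i l h
      exact Fin.ext (hinj i l (by omega) (by omega) h), by
      intro x
      obtain ⟨i, hi, rfl⟩ := hsurj x
      exact ⟨⟨i, by omega⟩, rfl⟩⟩
  have hstep : ∀ i : Fin (n+3), G.Adj (e i) (e (i+1)) := by
    intro i
    change G.Adj (p i) (p (i+1 : Fin (n+3)))
    rw [Fin.val_add_one]
    split_ifs with h
    · rw [h]; exact hr0
    · have : i.val ≠ n + 2 := fun h' => h (Fin.ext h')
      exact hadj i (by omega)
  have hfwd : ∀ i l, (SimpleGraph.cycleGraph (n+3)).Adj i l → G.Adj (e i) (e l) := by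
    intro i l h
    rw [SimpleGraph.cycleGraph_adj] at h
    rcases h with h | h
    · have := hstep l
      rw [show l + 1 = i by rw [← h]; abel] at this
      exact this.symm
    · have := hstep i
      rwa [show i + 1 = l by rw [← h]; abel] at this
  have hN : ∀ i, ((SimpleGraph.cycleGraph (n+3)).neighborFinset i).map e.toEmbedding
      = G.neighborFinset (e i) := by
    intro i
    apply Finset.eq_of_subset_of_card_le
    · intro x hx
      rw [Finset.mem_map] at hx
      obtain ⟨l, hl, rfl⟩ := hx
      simp only [SimpleGraph.mem_neighborFinset] at hl ⊢
      exact hfwd i l hl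
    · rw [Finset.card_map, SimpleGraph.card_neighborFinset_eq_degree,
        SimpleGraph.card_neighborFinset_eq_degree, hreg, SimpleGraph.cycleGraph_degree_three_le]
  refine ⟨RelIso.symm ⟨e, ?_⟩⟩
  intro i l
  refine ⟨fun h => ?_, hfwd i l⟩
  have : e l ∈ G.neighborFinset (e i) := by simpa using h
  rw [← hN, Finset.mem_map] at this
  obtain ⟨l', hl', h'⟩ := this
  have : l' = l := e.injective h'
  subst this
  simpa using hl'

theorem brooks_main {V α : Type*} [Fintype V] [DecidableEq α]
    (G : SimpleGraph V) [DecidableRel G.Adj]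
    (hconn : G.Connected)
    (hcomplete : G ≠ ⊤)
    (hoddcycle : ¬ ∃ n : ℕ, Odd n ∧ 3 ≤ n ∧ Nonempty (G ≃g SimpleGraph.cycleGraph n))
    (L : V → Finset α) (D : ℕ) (hL : ∀ x : V, (L x).card = D) (hD : ∀ v, G.degree v = D) :
    ∃ f : V → α, (∀ x : V, f x ∈ L x) ∧ ∀ x y : V, G.Adj x y → f x ≠ f y := by
  classical
  have hdeg : ∀ v, G.degree v ≤ (L v).card := fun v => by rw [hL, hD]
  obtain ⟨a, b, c, hab, hbc, hac, hnac⟩ := exists_cherry G hconn hcomplete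
  obtain ⟨p, r, hr, p0, p1, p2, hadj, hinj, hmax⟩ := exists_long G a b c hab hbc hac
  have hD2 : 2 ≤ D := by
    rw [← hD b, ← G.card_neighborFinset_eq_degree, ← Finset.card_pair hac]
    apply Finset.card_le_card
    intro x hx
    simp at hx
    rcases hx with rfl | rfl
    · simpa using hab.symm
    · simpa using hbc
  have hjex : ∃ j, j < r ∧ G.Adj (p r) (p j) := ⟨r - 1, by omega, by
    have := hadj (r-1) (by omega)
    rw [show r - 1 + 1 = r by omega] at this
    exact this.symm⟩
  obtain ⟨hjr, hrj⟩ := Nat.find_spec hjex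
  have hjmin : ∀ i, i ≤ r → G.Adj (p r) (p i) → Nat.find hjex ≤ i := by
    intro i hi h
    have : i ≠ r := by rintro rfl; exact G.loopless.irrefl _ h
    exact Nat.find_min' hjex ⟨by omega, h⟩
  generalize Nat.find hjex = j at *
  by_cases hC : ∀ x, ∃ i, j ≤ i ∧ i ≤ r ∧ x = p i
  · -- Hamiltonian
    have hj0 : j = 0 := by
      obtain ⟨i, h1, h2, h3⟩ := hC (p 0)
      have := hinj 0 i (by omega) h2 h3
      omega
    subst hj0
    have hsurj : ∀ x, ∃ i ≤ r, x = p i := fun x => by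
      obtain ⟨i, h1, h2, h3⟩ := hC x
      exact ⟨i, h2, h3⟩
    rcases Nat.lt_or_ge 2 D with hD3 | hD3
    · -- degree at least three
      have : ∃ m, 3 ≤ m ∧ m ≤ r ∧ G.Adj b (p m) := by
        have : ∃ x ∈ G.neighborFinset b, x ∉ ({a, c} : Finset V) := by
          apply Finset.exists_mem_notMem_of_card_lt_card
          rw [Finset.card_pair hac, G.card_neighborFinset_eq_degree, hD]; exact hD3
        obtain ⟨x, hx, hx'⟩ := this
        obtain ⟨m, hm, rfl⟩ := hsurj x
        simp at hx hx'
        refine ⟨m, ?_, hm, hx⟩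
        by_contra! hlt
        interval_cases m
        · exact hx'.1 p0
        · rw [p1] at hx; exact G.loopless.irrefl _ hx
        · exact hx'.2 p2
      obtain ⟨m, hm3, hmr, hbm⟩ := this
      have hcol : ∃ x ∈ L a, ∃ y ∈ L c, x ∉ L b ∨ y ∉ L b ∨ x = y := by
        by_contra! hcon
        have hdis : Disjoint (L a) (L c) := by
          rw [Finset.disjoint_left]
          intro x hx hy
          exact (hcon x hx x hy).2.2 rfl
        obtain ⟨xa, hxa⟩ := Finset.card_pos.1 (by rw [hL a]; omega : 0 < (L a).card)
        obtain ⟨xc, hxc⟩ := Finset.card_pos.1 (by rw [hL c]; omega : 0 < (L c).card)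
        have hsub : L a ∪ L c ⊆ L b := by
          apply Finset.union_subset
          · exact fun x hx => (hcon x hx xc hxc).1
          · exact fun x hx => (hcon xa hxa x hx).2.1
        have := Finset.card_le_card hsub
        rw [Finset.card_union_of_disjoint hdis, hL, hL, hL] at this
        omega
      obtain ⟨x, hx, y, hy, hxy⟩ := hcol
      have hgood : GoodOn G L {a, c} (fun v => if v = a then x else y) := by
        constructor
        · intro v hv
          simp at hv
          rcases hv with rfl | rfl
          · simpa using hx
          · simpa [hac.symm] using hy
        · intro v hv w hw h
          simp at hv hw
          rcases hv with rfl | rfl <;> rcases hw with rfl | rfl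
          · exact absurd h (G.loopless.irrefl _)
          · exact absurd h hnac
          · exact absurd h.symm hnac
          · exact absurd h (G.loopless.irrefl _)
      have hcl : ∀ W : V → Prop, (∀ v, W v → ∀ u, G.Adj v u → u ∉ ({a, c} : Finset V) → W u) →
          (∀ v, W v → v ∉ ({a, c} : Finset V)) → (∃ v, W v) → W b := by
        intro W hW hWP ⟨v, hv⟩
        have hnP : ∀ i, 3 ≤ i → i ≤ r → p i ∉ ({a, c} : Finset V) := by
          intro i h3 hi h
          rw [← p0, ← p2] at h
          simp at h
          rcases h with h | h
          · have := hinj _ _ hi (by omega) h; omega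
          · have := hinj _ _ hi (by omega) h; omega
        have up : ∀ i l, W (p i) → 3 ≤ i → i + l ≤ r → W (p (i + l)) := by
          intro i l hi h3
          induction l with
          | zero => intros; exact hi
          | succ l ih =>
            intro h1
            exact hW _ (ih (by omega)) _ (hadj (i+l) (by omega)) (hnP _ (by omega) (by omega))
        have down : ∀ l i, W (p (i + l)) → 3 ≤ i → i + l ≤ r → W (p i) := by
          intro l
          induction l with
          | zero => intro i h _ _; exact h
          | succ l ih =>
            intro i h h3 h1
            exact ih i (hW _ h _ (hadj (i+l) (by omega)).symm (hnP _ (by omega) (by omega))) h3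
              (by omega)
        obtain ⟨i, hi, rfl⟩ := hsurj v
        by_cases hi3 : 3 ≤ i
        · have h3 : W (p 3) := down (i - 3) 3 (by rwa [show 3 + (i - 3) = i by omega]) le_rfl
            (by omega)
          have hm := up 3 (m - 3) h3 le_rfl (by omega)
          rw [show 3 + (m - 3) = m by omega] at hm
          exact hW _ hm _ hbm.symm (by simp [hab.ne', hbc.ne])
        · have h01 : i = 0 ∨ i = 1 ∨ i = 2 := by omega
          rcases h01 with rfl | rfl | rfl
          · exact absurd (by simp [p0]) (hWP _ hv)
          · rwa [p1] at hv
          · exact absurd (by simp [p2]) (hWP _ hv)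
      have hbP : b ∉ ({a, c} : Finset V) := by simp [hab.ne', hbc.ne]
      rcases hxy with h | h | h
      · exact finish_color G L hdeg _ _ hgood b hbP hcl a (by simp) hab.symm (by simp [h])
      · exact finish_color G L hdeg _ _ hgood b hbP hcl c (by simp) hbc (by simp [h, hac.symm])
      · exact finish_color G L hdeg _ _ hgood b hbP hcl a (by simp) hab.symm
          (Or.inr ⟨c, by simp, hac.symm, hbc, by simp [h]⟩)
    · -- degree two
      have hDe : D = 2 := by omega
      subst hDe
      by_cases hsame : ∀ i < r, L (p (i+1)) ⊆ L (p i)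
      · obtain ⟨φ⟩ := cyc_iso G hD p r hr hadj hinj hsurj hrj
        have hev : Even (r+1) := by
          by_contra h
          exact hoddcycle ⟨r+1, Nat.not_even_iff_odd.1 h, by omega, ⟨φ⟩⟩
        have hall : ∀ i ≤ r, L (p i) = L (p 0) := by
          intro i
          induction i with
          | zero => intro _; rfl
          | succ i ih =>
            intro hi
            rw [← ih (by omega)]
            exact Finset.eq_of_subset_of_card_le (hsame i (by omega)) (by rw [hL, hL])
        have hallx : ∀ x, L x = L (p 0) := by
          intro x
          obtain ⟨i, hi, rfl⟩ := hsurj x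
          exact hall i hi
        obtain ⟨x, y, hxy, hLe⟩ := Finset.card_eq_two.1 (hL (p 0))
        let C := SimpleGraph.cycleGraph.bicoloring_of_even (r+1) hev
        refine ⟨fun v => if C (φ v) then x else y, ?_, ?_⟩
        · intro v
          rw [hallx, hLe]
          dsimp only
          split_ifs <;> simp
        · intro v w h
          have := C.valid (φ.map_adj_iff.2 h)
          cases h1 : C (φ v) <;> cases h2 : C (φ w) <;> simp_all
          exact fun e => hxy e.symm
      · push Not at hsame
        obtain ⟨k, hk, hns⟩ := hsame
        obtain ⟨z, hz, hz'⟩ := Finset.not_subset.1 hns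
        refine cyc_color G L hdeg {p (k+1)} (fun _ => z) ⟨?_, ?_⟩ p r 0 k (by omega) hk hadj hrj
          ?_ ?_ (by simp) (p (k+1)) (by simp) (hadj k hk) (Or.inl hz')
        · intro v hv
          simp at hv
          rwa [hv]
        · intro v hv w hw h
          simp at hv hw
          rw [hv, hw] at h
          exact absurd h (G.loopless.irrefl _)
        · exact fun v => Or.inr (hC v)
        · intro i _ hi hne h
          simp at h
          exact hne (hinj _ _ hi (by omega) h)
  · -- C is a proper subset
    push Not at hC
    obtain ⟨o, ho⟩ := hC
    let inC : V → Prop := fun x => ∃ i, j ≤ i ∧ i ≤ r ∧ x = p i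
    let R : ℕ → Prop := fun i => j ≤ i ∧ ∃ u, G.Adj (p i) u ∧ ¬ inC u
    have hR : ∃ i ≤ r, R i := by
      by_contra! hcon
      have := conn_closed G hconn inC (by
        rintro v ⟨i, h1, h2, rfl⟩ u hu
        by_contra h
        exact hcon i h2 ⟨h1, u, hu, h⟩) (p r) ⟨r, by omega, le_rfl, rfl⟩ o
      obtain ⟨i, h1, h2, h3⟩ := this
      exact ho i h1 h2 h3
    have hRr : ¬ R r := by
      rintro ⟨_, u, hu, hn⟩
      obtain ⟨i, hi, rfl⟩ := hmax u hu
      exact hn ⟨i, hjmin i hi hu, hi, rfl⟩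
    obtain ⟨i0, hi0, hRi0⟩ := hR
    have hspec := Nat.findGreatest_spec (P := R) hi0 hRi0
    have hle := Nat.findGreatest_le (P := R) r
    have hgr : ∀ i, i ≤ r → R i → i ≤ Nat.findGreatest R r := fun i h h' => Nat.le_findGreatest h h'
    generalize Nat.findGreatest R r = k at *
    obtain ⟨hjk, u, hku, huC⟩ := hspec
    have hkr : k < r := by
      rcases Nat.lt_or_ge k r with h | h
      · exact h
      · have : k = r := by omega
        subst this
        exact absurd ⟨hjk, u, hku, huC⟩ hRr
    have hk1 : ∀ w, G.Adj (p (k+1)) w → inC w := by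
      intro w hw
      by_contra h
      have := hgr (k+1) (by omega) ⟨by omega, w, hw, h⟩
      omega
    -- color the outside
    obtain ⟨c0, -⟩ := Finset.card_pos.1 (by rw [hL a]; omega : 0 < (L a).card)
    obtain ⟨f, hf, -⟩ := ext_color' G L hdeg ∅ (fun _ => c0) ⟨by simp, by simp⟩ (p k) (by simp) (by
      intro W hW _ ⟨v, hv⟩
      exact conn_closed G hconn W (fun v hv u h => hW v hv u h (by simp)) v hv (p k))
    let O : Finset V := Finset.univ.filter (fun x => ¬ inC x)
    have hO : ∀ x, x ∈ O ↔ ¬ inC x := by simp [O]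
    have hinCp : ∀ i, j ≤ i → i ≤ r → inC (p i) := fun i h1 h2 => ⟨i, h1, h2, rfl⟩
    have hOsub : O ⊆ Finset.univ.erase (p k) := by
      intro x hx
      simp
      rintro rfl
      exact (hO _).1 hx (hinCp k hjk hle)
    have hfO : GoodOn G L O f :=
      ⟨fun x hx => hf.1 x (hOsub hx), fun x hx y hy => hf.2 x (hOsub hx) y (hOsub hy)⟩
    have hcol : ∃ z ∈ L (p (k+1)), f u ∉ L (p k) ∨ z ∉ L (p k) ∨ z = f u := by
      by_contra! hcon
      obtain ⟨xa, hxa⟩ := Finset.card_pos.1 (by rw [hL]; omega : 0 < (L (p (k+1))).card)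
      have hsub : L (p (k+1)) ⊆ (L (p k)).erase (f u) := by
        intro z hz
        exact Finset.mem_erase.2 ⟨(hcon z hz).2.2, (hcon z hz).2.1⟩
      have h1 := Finset.card_le_card hsub
      have h2 := Finset.card_erase_lt_of_mem (hcon xa hxa).1
      rw [hL] at h1 h2
      omega
    obtain ⟨z, hz, hzz⟩ := hcol
    have hk1O : p (k+1) ∉ O := fun h => (hO _).1 h (hinCp _ (by omega) (by omega))
    have hg := hfO.ins hk1O hz (by
      intro w hw h
      exact absurd (hk1 w h) ((hO w).1 hw))
    have huO : u ∈ O := (hO u).2 huC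
    have hune : u ≠ p (k+1) := fun h => hk1O (h ▸ huO)
    have key := cyc_color G L hdeg _ _ hg p r j k hjk hkr hadj hrj
      (by
        intro x
        by_cases h : inC x
        · exact Or.inr h
        · exact Or.inl (Finset.mem_insert_of_mem ((hO x).2 h)))
      (by
        intro i h1 h2 hne h
        rcases Finset.mem_insert.1 h with h | h
        · exact hne (hinj _ _ h2 (by omega) h)
        · exact (hO _).1 h (hinCp i h1 h2))
      (Finset.mem_insert_self _ _)
    rcases hzz with h | h | h
    · exact key u (Finset.mem_insert_of_mem huO) hku
        (Or.inl (by rwa [Function.update_of_ne hune]))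
    · exact key (p (k+1)) (Finset.mem_insert_self _ _) (hadj k hkr)
        (Or.inl (by rwa [Function.update_self]))
    · exact key (p (k+1)) (Finset.mem_insert_self _ _) (hadj k hkr)
        (Or.inr ⟨u, Finset.mem_insert_of_mem huO, hune, hku, by
          rw [Function.update_self, Function.update_of_ne hune, h]⟩)

/-- Brooks' theorem, list version: a connected finite graph with maximum degree `Δ` that is
neither a complete graph nor an odd cycle can be properly colored from any lists of size at
least `Δ`. -/
theorem brooks_list {V α : Type*} [Fintype V] [DecidableEq α]
    (G : SimpleGraph V) [DecidableRel G.Adj]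
    (hconn : G.Connected)
    (hcomplete : G ≠ ⊤)
    (hoddcycle : ¬ ∃ n : ℕ, Odd n ∧ 3 ≤ n ∧ Nonempty (G ≃g SimpleGraph.cycleGraph n))
    (L : V → Finset α) (hL : ∀ x : V, G.maxDegree ≤ (L x).card) :
    ∃ f : V → α, (∀ x : V, f x ∈ L x) ∧ ∀ x y : V, G.Adj x y → f x ≠ f y := by
  have hdeg : ∀ v, G.degree v ≤ (L v).card := fun v => (G.degree_le_maxDegree v).trans (hL v)
  by_cases h : ∃ t, G.degree t < (L t).card
  · obtain ⟨t, ht⟩ := h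
    exact nonreg_color G hconn L hdeg t ht
  · push Not at h
    refine brooks_main G hconn hcomplete hoddcycle L G.maxDegree (fun x => ?_) (fun x => ?_)
    · exact le_antisymm ((h x).trans (G.degree_le_maxDegree x)) (hL x)
    · exact le_antisymm (G.degree_le_maxDegree x) ((hL x).trans (h x))
end

section
/- Brooks' theorem: Let G be a connected finite simple graph with maximum degree Δ. If G is neither a complete graph nor an odd cycle, then G is Δ-colorable, i.e., the chromatic number of G is at most Δ. -/
open Finset

def BValid {V : Type*} (G : SimpleGraph V) {k : ℕ} (c : V → Fin k) (A : Finset V) : Prop :=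
  ∀ u ∈ A, ∀ w ∈ A, G.Adj u w → c u ≠ c w

open Classical in
lemma b_extend {V : Type*} [Fintype V] (G : SimpleGraph V) {k : ℕ} (c : V → Fin k) (A : Finset V)
    (hc : BValid G c A) (v : V) (hv : v ∉ A)
    (h : ((A.filter (G.Adj v)).image c).card < k) :
    ∃ c' : V → Fin k, BValid G c' (insert v A) ∧ ∀ u ∈ A, c' u = c u := by
  obtain ⟨a, ha⟩ : ∃ a, a ∉ (A.filter (G.Adj v)).image c := by
    by_contra hcon
    push Not at hcon
    rw [Finset.eq_univ_iff_forall.2 hcon] at h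
    simp at h
  have ha' : ∀ u ∈ A, G.Adj v u → c u ≠ a := by
    intro u hu huv e
    exact ha (mem_image.2 ⟨u, by simp [hu, huv], e⟩)
  refine ⟨Function.update c v a, ?_, ?_⟩
  · intro u hu w hw huw
    rw [mem_insert] at hu hw
    have := huw.ne
    by_cases h1 : u = v
    · subst h1
      have h2 : w ≠ u := this.symm
      simp only [Function.update_self, Function.update_of_ne h2]
      exact (ha' w (by tauto) huw).symm
    · by_cases h2 : w = v
      · subst h2
        simp only [Function.update_self, Function.update_of_ne h1]
        exact (ha' u (by tauto) huw.symm)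
      · simp only [Function.update_of_ne h1, Function.update_of_ne h2]
        exact hc u (by tauto) w (by tauto) huw
  · intro u hu
    exact Function.update_of_ne (by rintro rfl; exact hv hu) _ _

open Classical in
lemma b_extend1 {V : Type*} [Fintype V] (G : SimpleGraph V) {k : ℕ}
    (hd : ∀ v, (univ.filter (G.Adj v)).card ≤ k) (c : V → Fin k) (A : Finset V)
    (hc : BValid G c A) (v : V) (hv : v ∉ A) (w : V) (hw : w ∉ A) (hvw : G.Adj v w) :
    ∃ c' : V → Fin k, BValid G c' (insert v A) ∧ ∀ u ∈ A, c' u = c u := by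
  apply b_extend G c A hc v hv
  refine lt_of_le_of_lt card_image_le (lt_of_lt_of_le ?_ (hd v))
  apply card_lt_card
  refine ⟨fun u hu => by simp at hu ⊢; exact hu.2, fun hh => ?_⟩
  have := hh (show w ∈ _ by simp [hvw])
  simp [hw] at this

open Classical in
lemma b_extend2 {V : Type*} [Fintype V] (G : SimpleGraph V) {k : ℕ}
    (hd : ∀ v, (univ.filter (G.Adj v)).card ≤ k) (c : V → Fin k) (A : Finset V)
    (hc : BValid G c A) (v : V) (hv : v ∉ A) (x y : V) (hx : x ∈ A) (hy : y ∈ A)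
    (hvx : G.Adj v x) (hvy : G.Adj v y) (hxy : x ≠ y) (hcxy : c x = c y) :
    ∃ c' : V → Fin k, BValid G c' (insert v A) ∧ ∀ u ∈ A, c' u = c u := by
  apply b_extend G c A hc v hv
  have : ((A.filter (G.Adj v)).image c) ⊆ (((univ.filter (G.Adj v)).erase x).image c) := by
    intro a ha
    simp only [mem_image, mem_filter, mem_erase, mem_univ, true_and] at ha ⊢
    obtain ⟨u, ⟨hu, huv⟩, rfl⟩ := ha
    by_cases h : u = x
    · exact ⟨y, ⟨hxy.symm, hvy⟩, by rw [h, hcxy]⟩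
    · exact ⟨u, ⟨h, huv⟩, rfl⟩
  refine lt_of_le_of_lt (card_le_card this) (lt_of_le_of_lt card_image_le
    (lt_of_lt_of_le ?_ (hd v)))
  exact card_erase_lt_of_mem (by simp [hvx])

open Classical in
lemma b_path {V : Type*} [Fintype V] (G : SimpleGraph V) {k : ℕ}
    (hd : ∀ v, (univ.filter (G.Adj v)).card ≤ k) (w : V) (l : List V) :
    ∀ (c : V → Fin k) (A : Finset V), BValid G c A → (l ++ [w]).Nodup →
    (∀ u ∈ l ++ [w], u ∉ A) → List.IsChain G.Adj (l ++ [w]) →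
    ∃ c' : V → Fin k, BValid G c' (A ∪ l.toFinset) ∧ ∀ u ∈ A, c' u = c u := by
  induction l with
  | nil => intro c A hc _ _ _; exact ⟨c, by simpa using hc, fun _ _ => rfl⟩
  | cons a l ih =>
    intro c A hc hn hA hch
    rw [List.cons_append] at hn hch hA
    rw [List.nodup_cons] at hn
    obtain ⟨b, hb, hab⟩ : ∃ b ∈ l ++ [w], G.Adj a b := by
      cases l with
      | nil => simp at hch; exact ⟨w, by simp, hch⟩
      | cons d l => simp at hch; exact ⟨d, by simp, hch.1⟩
    obtain ⟨c1, hc1, h1⟩ := b_extend1 G hd c A hc a (hA a (by simp)) b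
      (hA b (List.mem_cons_of_mem _ hb)) hab
    obtain ⟨c2, hc2, h2⟩ := ih c1 (insert a A) hc1 hn.2 (by
      intro u hu hu'
      rw [mem_insert] at hu'
      rcases hu' with rfl | hu'
      · exact hn.1 hu
      · exact hA u (List.mem_cons_of_mem _ hu) hu') hch.of_cons
    refine ⟨c2, ?_, fun u hu => ?_⟩
    · convert hc2 using 1
      ext; simp
    · rw [h2 u (by simp [hu]), h1 u hu]

/-- extension of a nodup path to a maximal one -/
lemma b_maxpath {V : Type*} [Fintype V] (G : SimpleGraph V) (L0 : List V) (h0 : L0 ≠ [])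
    (hn : L0.Nodup) (hch : L0.IsChain G.Adj) (m : ℕ) :
    Fintype.card V - L0.length ≤ m →
    ∃ t h t', t ++ L0 = h :: t' ∧ (t ++ L0).Nodup ∧ (t ++ L0).IsChain G.Adj ∧
      ∀ u, G.Adj h u → u ∈ t ++ L0 := by
  induction m generalizing L0 with
  | zero =>
    intro hm
    obtain ⟨h, t', rfl⟩ := List.exists_cons_of_ne_nil h0
    refine ⟨[], h, t', rfl, hn, hch, ?_⟩
    intro u hu
    by_contra hcon
    have := List.Nodup.length_le_card (l := u :: h :: t') (by
      rw [List.nodup_cons]; exact ⟨by simpa using hcon, hn⟩)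
    simp at this hm
    omega
  | succ m ih =>
    intro hm
    obtain ⟨h, t', rfl⟩ := List.exists_cons_of_ne_nil h0
    by_cases hall : ∀ u, G.Adj h u → u ∈ h :: t'
    · exact ⟨[], h, t', rfl, hn, hch, hall⟩
    · push Not at hall
      obtain ⟨u, hu, hu'⟩ := hall
      obtain ⟨t, a, b, h1, h2, h3, h4⟩ := ih (u :: h :: t') (by simp)
        (by rw [List.nodup_cons]; exact ⟨hu', hn⟩)
        (by rw [List.isChain_cons_cons]; exact ⟨hu.symm, hch⟩)
        (by simp at hm ⊢; omega)
      refine ⟨t ++ [u], a, b, ?_⟩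
      simp only [List.append_assoc, List.singleton_append] at *
      exact ⟨h1, h2, h3, h4⟩

/-- split at last element satisfying p -/
lemma b_split_last {α : Type*} (p : α → Prop) (l : List α) (h : ∃ a ∈ l, p a) :
    ∃ l1 a l2, l = l1 ++ a :: l2 ∧ p a ∧ ∀ b ∈ l2, ¬ p b := by
  induction l with
  | nil => simp at h
  | cons x l ih =>
    by_cases hl : ∃ a ∈ l, p a
    · obtain ⟨l1, a, l2, rfl, h1, h2⟩ := ih hl
      exact ⟨x :: l1, a, l2, rfl, h1, h2⟩
    · push Not at hl
      refine ⟨[], x, l, rfl, ?_, hl⟩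
      obtain ⟨a, ha, hpa⟩ := h
      rcases List.mem_cons.1 ha with rfl | ha
      · exact hpa
      · exact absurd hpa (hl a ha)

lemma b_split_step {α : Type*} (p : α → Prop) (l : List α) (x : α) (hx : ¬ p x)
    (h : ∃ a ∈ x :: l, p a) :
    ∃ l1 a b l2, x :: l = l1 ++ a :: b :: l2 ∧ ¬ p a ∧ p b := by
  induction l generalizing x with
  | nil => simp at h; exact absurd h hx
  | cons y l ih =>
    by_cases hy : p y
    · exact ⟨[], x, y, l, rfl, hx, hy⟩
    · obtain ⟨l1, a, b, l2, h1, h2⟩ := ih y hy (by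
        obtain ⟨a, ha, hpa⟩ := h
        rcases List.mem_cons.1 ha with rfl | ha
        · exact absurd hpa hx
        · exact ⟨a, ha, hpa⟩)
      exact ⟨x :: l1, a, b, l2, by rw [h1]; rfl, h2⟩

open Classical in
/-- The non-spanning cycle case -/
lemma b_cycle {V : Type*} [Fintype V] (G : SimpleGraph V) {k : ℕ}
    (hd : ∀ v, (univ.filter (G.Adj v)).card ≤ k) (S : Finset V) (C : List V)
    (hn : C.Nodup) (hch : C.IsChain G.Adj) (h z : V) (t t' : List V) (hh : C = h :: t)
    (hz : C = t' ++ [z]) (hhz : G.Adj z h) (hin : ∀ u, G.Adj h u → u ∈ C)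
    (hCS : ∀ u ∈ C, u ∈ S) (c : V → Fin k) (hc : BValid G c (S \ C.toFinset))
    (hex : ∃ u ∈ C, ∃ q ∈ S, q ∉ C ∧ G.Adj u q) :
    ∃ c : V → Fin k, BValid G c S := by
  obtain ⟨l1, a, b, l2, hl, ha, q, hqS, hqC, hbq⟩ :=
    b_split_step (fun u => ∃ q ∈ S, q ∉ C ∧ G.Adj u q) t h
    (by rintro ⟨q, _, hq, hq'⟩; exact hq (hin q hq')) (by rw [← hh]; exact hex)
  rw [← hh] at hl
  -- colour a like q
  set A := S \ C.toFinset with hA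
  have haC : a ∈ C := by rw [hl]; simp
  have hbC : b ∈ C := by rw [hl]; simp
  have hab : a ≠ b := by
    rintro rfl
    rw [hl] at hn
    simp [List.nodup_append] at hn
  have hc1 : BValid G (Function.update c a (c q)) (insert a A) := by
    intro u hu w hw huw
    have key : ∀ w ∈ insert a A, ¬ G.Adj a w := by
      intro w hw haw
      rcases mem_insert.1 hw with rfl | hw
      · exact haw.ne rfl
      · simp [hA] at hw
        exact ha ⟨w, hw.1, hw.2, haw⟩
    have h1 : u ≠ a := by rintro rfl; exact key w hw huw
    have h2 : w ≠ a := by rintro rfl; exact key u hu huw.symm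
    rw [Function.update_of_ne h1, Function.update_of_ne h2]
    rw [mem_insert] at hu hw
    exact hc u (by tauto) w (by tauto) huw
  have hrot : (b :: l2 ++ (l1 ++ [a])).IsChain G.Adj := by
    rw [List.isChain_append]
    have e : C = (l1 ++ [a]) ++ (b :: l2) := by rw [hl]; simp
    rw [e, List.isChain_append] at hch
    refine ⟨hch.2.1, hch.1, ?_⟩
    intro x hx y hy
    have hx' : x = z := by
      have : C.getLast? = some x := by rw [e, List.getLast?_append, hx]; rfl
      rw [hz] at this; simpa using this.symm
    have hy' : y = h := by
      have : C.head? = some y := by rw [e, List.head?_append, hy]; rfl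
      rw [hh] at this; simpa using this.symm
    rw [hx', hy']; exact hhz
  have hperm : (b :: l2 ++ (l1 ++ [a])).Perm C := by
    rw [hl, show l1 ++ a :: b :: l2 = (l1 ++ [a]) ++ (b :: l2) by simp]
    exact List.perm_append_comm
  have hrn : (b :: l2 ++ (l1 ++ [a])).Nodup := hperm.nodup_iff.2 hn
  have e1 : (b :: l2 ++ (l1 ++ [a])) = (b :: (l2 ++ l1)) ++ [a] := by simp
  rw [e1] at hrn hrot hperm
  have hrn2 := hrn
  rw [List.nodup_append] at hrn2
  have e2 : (l2 ++ l1).reverse ++ [b] = (b :: (l2 ++ l1)).reverse := by simp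
  have hbl : ∀ u ∈ b :: (l2 ++ l1), u ∈ C := fun u hu =>
    hperm.mem_iff.1 (List.mem_append_left _ hu)
  obtain ⟨c2, hc2, h2⟩ := b_path G hd b (l2 ++ l1).reverse _ (insert a A) hc1
    (by rw [e2, List.nodup_reverse]; exact hrn2.1)
    (by
      rw [e2]
      intro u hu hu'
      rw [List.mem_reverse] at hu
      rcases mem_insert.1 hu' with rfl | hu'
      · exact hrn2.2.2 _ hu _ (by simp) rfl
      · simp [hA] at hu'
        exact hu'.2 (hbl u hu))
    (by
      rw [e2, List.isChain_reverse]
      have := (List.isChain_append.1 hrot).1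
      exact this.imp fun _ _ h => h.symm)
  have hqA : q ∈ A := by simp [hA, hqS, hqC]
  have hqa : q ≠ a := by rintro rfl; exact hqC haC
  have hb2 : G.Adj b a := by
    rw [hl] at hch
    have := (List.isChain_append.1 hch).2.1
    rw [List.isChain_cons_cons] at this
    exact this.1.symm
  obtain ⟨c3, hc3, -⟩ := b_extend2 G hd c2 _ hc2 b (by
      simp only [mem_union, mem_insert, List.mem_toFinset, List.mem_reverse, hA, mem_sdiff]
      rw [List.nodup_cons] at hrn2
      rintro ((h | h) | h)
      · exact hab h.symm
      · exact h.2 hbC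
      · exact hrn2.1.1 h) q a (by simp [hqA]) (by simp) hbq hb2 hqa (by
      rw [h2 q (by simp [hqA]), h2 a (by simp), Function.update_self, Function.update_of_ne hqa])
  refine ⟨c3, ?_⟩
  have : S ⊆ (insert b (insert a A ∪ (l2 ++ l1).reverse.toFinset)) := by
    intro u hu
    by_cases huC : u ∈ C
    · rw [hl] at huC
      simp at huC ⊢
      tauto
    · simp [hA, hu, huC]
  exact fun u hu w hw => hc3 u (this hu) w (this hw)

open Classical in
lemma b_ham {V : Type*} [Fintype V] (G : SimpleGraph V) {k : ℕ} (hk : 3 ≤ k)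
    (hd : ∀ v, (univ.filter (G.Adj v)).card = k ∨ (univ.filter (G.Adj v)).card ≤ k)
    (S : Finset V) (t : List V) (x y v : V) (hn : (t ++ [y, v, x]).Nodup)
    (hch : (t ++ [y, v, x]).IsChain G.Adj) (hxy : ¬ G.Adj x y)
    (hv : (univ.filter (G.Adj v)).card = k) (hS : ∀ u, u ∈ S ↔ u ∈ t ++ [y, v, x])
    (hcl : ∀ u, G.Adj v u → u ∈ S) :
    ∃ c : V → Fin k, BValid G c S := by
  have hd' : ∀ v, (univ.filter (G.Adj v)).card ≤ k := fun v => (hd v).elim le_of_eq id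
  obtain ⟨z, hz⟩ : ∃ z, z ∈ univ.filter (G.Adj v) \ {x, y} := by
    apply Finset.Nonempty.exists_mem
    rw [← card_pos]
    have := le_card_sdiff {x, y} (univ.filter (G.Adj v))
    have h2 : ({x, y} : Finset V).card ≤ 2 := card_le_two
    omega
  simp only [mem_sdiff, mem_filter, mem_univ, true_and, mem_insert, mem_singleton, not_or] at hz
  obtain ⟨hvz, hzx, hzy⟩ := hz
  have hzt : z ∈ t := by
    have := (hS z).1 (hcl z hvz)
    simp at this
    have := hvz.ne'
    tauto
  obtain ⟨t1, t2, rfl⟩ := List.append_of_mem hzt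
  have hnn := hn
  simp [List.nodup_append] at hn
  have hch2 := (List.isChain_append.1 hch)
  have hvyx : G.Adj y v ∧ G.Adj v x := by
    have := hch2.2.1
    simpa using this
  have hc0 : BValid G (fun _ => (⟨0, by omega⟩ : Fin k)) {x, y} := by
    intro a ha b hb hab
    exfalso
    simp at ha hb
    rcases ha with rfl | rfl <;> rcases hb with rfl | rfl
    · exact hab.ne rfl
    · exact hxy hab
    · exact hxy hab.symm
    · exact hab.ne rfl
  have hc12 := List.isChain_append.1 hch2.1
  obtain ⟨c1, hc1, h1⟩ := b_path G hd' z t2.reverse _ {x, y} hc0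
    (by simp [List.nodup_append]; grind) (by simp; grind) (by
      have := hc12.2.1
      rw [show t2.reverse ++ [z] = (z :: t2).reverse by simp, List.isChain_reverse]
      exact this.imp fun _ _ h => h.symm)
  obtain ⟨c2, hc2, h2⟩ := b_path G hd' v (t1 ++ [z]) c1 _ hc1
    (by simp [List.nodup_append]; grind) (by simp; grind) (by
      have e : t1 ++ z :: t2 = (t1 ++ [z]) ++ t2 := by simp
      rw [List.isChain_append]
      refine ⟨?_, by simp, ?_⟩
      · have := hch2.1
        rw [e] at this
        exact (List.isChain_append.1 this).1
      · simp
        exact hvz.symm)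
  obtain ⟨c3, hc3, -⟩ := b_extend2 G hd' c2 _ hc2 v (by simp; grind) x y (by simp) (by simp)
    hvyx.2 hvyx.1.symm (by grind) (by
      rw [h2 x (by simp), h2 y (by simp), h1 x (by simp), h1 y (by simp)])
  refine ⟨c3, ?_⟩
  have key : ∀ u ∈ S, u ∈ insert v ({x, y} ∪ t2.reverse.toFinset ∪ (t1 ++ [z]).toFinset) := by
    intro u hu
    have := (hS u).1 hu
    simp at this ⊢
    tauto
  exact fun u hu w hw => hc3 u (key u hu) w (key w hw)

open Classical in
lemma b_iso {V : Type*} [Fintype V] (G : SimpleGraph V) 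
    (hd : ∀ v, (univ.filter (G.Adj v)).card = 2) (C : List V) (hn : C.Nodup)
    (hch : C.IsChain G.Adj) (h z : V) (t t' : List V) (hh : C = h :: t) (hz : C = t' ++ [z])
    (hzh : G.Adj z h) (hall : ∀ u, u ∈ C) (h3 : 3 ≤ C.length) :
    Nonempty (G ≃g SimpleGraph.cycleGraph C.length) := by
  obtain ⟨n, hnl⟩ : ∃ n, C.length = n + 3 := ⟨C.length - 3, by omega⟩
  let f : Fin (n + 3) → V := fun i => C[i.1]'(by omega)
  have hinj : Function.Injective f := by
    intro i j hij
    have := (List.Nodup.getElem_inj_iff hn).1 hij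
    exact Fin.ext this
  have hsurj : Function.Surjective f := by
    intro v
    obtain ⟨i, hi, e⟩ := List.mem_iff_getElem.1 (hall v)
    exact ⟨⟨i, by omega⟩, e⟩
  have hstep : ∀ i : Fin (n + 3), G.Adj (f i) (f (i + 1)) := by
    intro i
    by_cases hi : i = Fin.last (n + 2)
    · subst hi
      have e1 : f (Fin.last (n + 2)) = z := by
        simp only [f, Fin.val_last]
        have : C[n+2]'(by omega) = C.getLast (by rw [hh]; simp) := by
          rw [List.getLast_eq_getElem]; simp [hnl]
        rw [this]
        simp [hz]
      have e2 : f (Fin.last (n + 2) + 1) = h := by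
        simp [f, hh]
      rw [e1, e2]; exact hzh
    · have hlt : i.1 < n + 2 := by
        have := Fin.val_lt_last hi
        simpa using this
      have hv : (i + 1).1 = i.1 + 1 := Fin.val_add_one_of_lt (by
        rw [Fin.lt_def]; simpa using hlt)
      simp only [f, hv]
      exact List.isChain_iff_getElem.1 hch i.1 (by omega)
  have hne : ∀ i : Fin (n + 3), i + 1 ≠ i - 1 := by
    intro i e
    have : (1 : Fin (n+3)) + 1 = 0 := by
      have := congrArg (fun x => x - i + 1) e
      simp at this
      rw [← this]
    have := congrArg Fin.val this
    simp [Fin.val_add] at this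
    rw [Nat.mod_eq_of_lt (by omega)] at this
    omega
  have hnb : ∀ i, univ.filter (G.Adj (f i)) = {f (i + 1), f (i - 1)} := by
    intro i
    symm
    apply eq_of_subset_of_card_le
    · intro u hu
      simp at hu
      rcases hu with rfl | rfl
      · simpa using hstep i
      · have := hstep (i - 1)
        simp at this
        simpa using this.symm
    · rw [hd, card_pair (fun e => hne i (hinj e))]
  rw [hnl]
  refine ⟨SimpleGraph.Iso.symm ⟨Equiv.ofBijective f ⟨hinj, hsurj⟩, ?_⟩⟩
  intro i j
  change G.Adj (f i) (f j) ↔ _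
  have : G.Adj (f i) (f j) ↔ f j ∈ univ.filter (G.Adj (f i)) := by simp
  rw [this, hnb, SimpleGraph.cycleGraph_adj]
  simp only [mem_insert, mem_singleton, hinj.eq_iff]
  constructor
  · rintro (rfl | rfl)
    · right; abel
    · left; abel
  · rintro (h | h)
    · right; rw [← h]; abel
    · left; rw [← h]; abel

lemma b_univ {V : Type*} [Fintype V] (G : SimpleGraph V) (hconn : G.Connected) (S : Finset V)
    (hne : S.Nonempty) (hcl : ∀ v ∈ S, ∀ u, G.Adj v u → u ∈ S) : ∀ u, u ∈ S := by
  obtain ⟨v, hv⟩ := hne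
  intro u
  obtain ⟨p⟩ := hconn.preconnected v u
  induction p with
  | nil => exact hv
  | cons h p ih => exact ih (hcl _ hv _ h)

open Classical in
lemma b_main {V : Type*} [Fintype V] (G : SimpleGraph V) (hconn : G.Connected) {k : ℕ}
    (hk : 0 < k) (hd : ∀ v, (univ.filter (G.Adj v)).card ≤ k) (hcf : G.CliqueFree (k + 1))
    (hoddcycle : ¬ ∃ n : ℕ, Odd n ∧ 3 ≤ n ∧ Nonempty (G ≃g SimpleGraph.cycleGraph n))
    (S : Finset V) : ∃ c : V → Fin k, BValid G c S := by
  induction S using Finset.strongInduction with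
  | H S ih =>
  rcases S.eq_empty_or_nonempty with rfl | hne
  · exact ⟨fun _ => ⟨0, hk⟩, by intro u hu; simp at hu⟩
  by_cases hlow : ∃ v ∈ S, (S.filter (G.Adj v)).card < k
  · obtain ⟨v, hv, hlt⟩ := hlow
    obtain ⟨c, hc⟩ := ih (S.erase v) (erase_ssubset hv)
    obtain ⟨c', hc', -⟩ := b_extend G c _ hc v (by simp) (lt_of_le_of_lt card_image_le
      (lt_of_le_of_lt (card_le_card (filter_subset_filter _ (erase_subset v S))) hlt))
    rw [insert_erase hv] at hc'
    exact ⟨c', hc'⟩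
  push Not at hlow
  have heq : ∀ v ∈ S, S.filter (G.Adj v) = univ.filter (G.Adj v) := fun v hv =>
    eq_of_subset_of_card_le (filter_subset_filter _ (subset_univ _)) ((hd v).trans (hlow v hv))
  have hreg : ∀ v ∈ S, (univ.filter (G.Adj v)).card = k := fun v hv =>
    le_antisymm (hd v) (by rw [← heq v hv]; exact hlow v hv)
  have hcl : ∀ v ∈ S, ∀ u, G.Adj v u → u ∈ S := by
    intro v hv u huv
    have : u ∈ univ.filter (G.Adj v) := by simp [huv]
    rw [← heq v hv] at this
    exact (mem_filter.1 this).1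
  obtain ⟨v, hv⟩ := hne
  obtain ⟨x, y, hvx, hvy, hxy, hnadj⟩ : ∃ x y, G.Adj v x ∧ G.Adj v y ∧ x ≠ y ∧ ¬ G.Adj x y := by
    by_contra hcon
    push Not at hcon
    apply hcf (insert v (univ.filter (G.Adj v)))
    constructor
    · intro a ha b hb hab
      simp at ha hb
      rcases ha with rfl | ha <;> rcases hb with rfl | hb
      · exact absurd rfl hab
      · exact hb
      · exact ha.symm
      · exact hcon a b ha hb hab
    · rw [card_insert_of_notMem (by simp), hreg v hv]
  obtain ⟨t, h, t', hL, hn, hch, hin⟩ := b_maxpath G [y, v, x] (by simp)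
    (by simp; exact ⟨⟨hvy.ne', hxy.symm⟩, hvx.ne⟩) (by simp; exact ⟨hvy.symm, hvx⟩) _ le_rfl
  set L := t ++ [y, v, x] with hLdef
  have hLS : ∀ u ∈ L, u ∈ S := by
    -- chain closed under adjacency
    have hSu : ∀ u, u ∈ S := b_univ G hconn S ⟨v, hv⟩ hcl
    exact fun u _ => hSu u
  have hhL : h ∈ L := by rw [hL]; simp
  have hhS := hLS h hhL
  have hk2 : 2 ≤ k := by
    rw [← hreg v hv, ← card_pair hxy]
    apply card_le_card
    intro u hu
    simp at hu ⊢
    rcases hu with rfl | rfl <;> assumption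
  obtain ⟨l1, z, l2, hsp, hhz, hl2⟩ := b_split_last (fun u => G.Adj h u) L (by
    have : 0 < (univ.filter (G.Adj h)).card := by rw [hreg h hhS]; exact hk
    obtain ⟨u, hu⟩ := card_pos.1 this
    simp at hu
    exact ⟨u, hin u hu, hu⟩)
  set C := l1 ++ [z] with hC
  have hLC : L = C ++ l2 := by rw [hsp]; simp [hC]
  have hCL : ∀ u ∈ C, u ∈ L := fun u hu => by rw [hLC]; simp [hu]
  have hCn : C.Nodup := by rw [hLC] at hn; exact (List.nodup_append.1 hn).1
  have hCch : C.IsChain G.Adj := by rw [hLC] at hch; exact (List.isChain_append.1 hch).1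
  have hCin : ∀ u, G.Adj h u → u ∈ C := by
    intro u hu
    have := hin u hu
    rw [hLC, List.mem_append] at this
    rcases this with h | h
    · exact h
    · exact absurd hu (hl2 u h)
  obtain ⟨s, hs⟩ : ∃ s, C = h :: s := by
    rw [hLC] at hL
    cases hC' : C with
    | nil => simp [hC] at hC'
    | cons a s =>
      rw [hC'] at hL
      simp at hL
      exact ⟨s, by rw [hL.1]⟩
  have hhC : h ∈ C := by rw [hs]; simp
  by_cases hfull : ∀ u ∈ S, u ∈ C
  · rcases (show k = 2 ∨ 3 ≤ k by omega) with rfl | hk3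
    · have hSu : ∀ u, u ∈ S := b_univ G hconn S ⟨v, hv⟩ hcl
      have h3 : 3 ≤ C.length := by
        have h1 := List.toFinset_card_of_nodup hCn
        rw [← h1]
        have h2 : ({v, x, y} : Finset V).card = 3 := by
          rw [card_eq_three]; exact ⟨v, x, y, hvx.ne, hvy.ne, hxy, rfl⟩
        rw [← h2]
        apply card_le_card
        intro u _
        simpa using hfull u (hSu u)
      obtain ⟨φ⟩ := b_iso G (fun v => hreg v (hSu v)) C hCn hCch h z s l1 hs hC hhz.symm
        (fun u => hfull u (hSu u)) h3
      have hev : Even C.length := by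
        rw [← Nat.not_odd_iff_even]
        intro ho
        exact hoddcycle ⟨_, ho, h3, ⟨φ⟩⟩
      have hcol : (SimpleGraph.cycleGraph C.length).Colorable 2 := by
        have := SimpleGraph.chromaticNumber_cycleGraph_of_even C.length (by omega) hev
        exact SimpleGraph.chromaticNumber_le_iff_colorable.1 (by rw [this]; rfl)
      obtain ⟨col⟩ := hcol
      exact ⟨fun u => col (φ u), fun a _ b _ hab => col.valid (φ.map_rel_iff.2 hab)⟩
    · exact b_ham G hk3 (fun v => Or.inr (hd v)) S t x y v hn hch hnadj (hreg v hv)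
        (fun u => ⟨fun hu => hCL u (hfull u hu), hLS u⟩) (hcl v hv)
  · push Not at hfull
    obtain ⟨q, hqS, hqC⟩ := hfull
    obtain ⟨c, hc⟩ := ih (S \ C.toFinset) (by
      refine ⟨sdiff_subset, fun hh => ?_⟩
      have := hh hhS
      simp [hhC] at this)
    refine b_cycle G hd S C hCn hCch h z s l1 hs hC hhz.symm hCin (fun u hu => hLS u (hCL u hu))
      c hc ?_
    by_contra hcon
    push Not at hcon
    have := b_univ G hconn C.toFinset ⟨h, by simpa using hhC⟩ (by
      intro a ha u hau
      simp at ha ⊢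
      by_contra hu
      exact hcon a ha u (hcl a (hLS a (hCL a ha)) u hau) hu hau)
    exact hqC (by simpa using this q)




/-- Brooks' theorem: a connected finite graph with maximum degree `Δ` that is neither a
complete graph nor an odd cycle has chromatic number at most `Δ`. -/
theorem brooks {V : Type*} [Fintype V] (G : SimpleGraph V) [DecidableRel G.Adj]
    (hconn : G.Connected)
    (hcomplete : G ≠ ⊤)
    (hoddcycle : ¬ ∃ n : ℕ, Odd n ∧ 3 ≤ n ∧ Nonempty (G ≃g SimpleGraph.cycleGraph n)) :
    G.chromaticNumber ≤ (G.maxDegree : ℕ∞) := by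
  classical
  have hd : ∀ v, (univ.filter (G.Adj v)).card ≤ G.maxDegree := by
    intro v
    have := G.degree_le_maxDegree v
    rw [← G.card_neighborFinset_eq_degree, G.neighborFinset_eq_filter] at this
    convert this
  have hcf : G.CliqueFree (G.maxDegree + 1) := by
    intro s hs
    have hcl : ∀ v ∈ s, ∀ u, G.Adj v u → u ∈ s := by
      intro v hv u huv
      have hsub : s.erase v ⊆ univ.filter (G.Adj v) := by
        intro w hw
        rw [mem_erase] at hw
        simpa using hs.1 hv hw.2 hw.1.symm
      have := eq_of_subset_of_card_le hsub ((hd v).trans (by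
        rw [card_erase_of_mem hv, hs.2]; simp))
      have hu : u ∈ univ.filter (G.Adj v) := by simp [huv]
      rw [← this] at hu
      exact (mem_erase.1 hu).2
    have hu := b_univ G hconn s (by rw [← card_pos, hs.2]; omega) hcl
    apply hcomplete
    ext a b
    simp only [SimpleGraph.top_adj]
    exact ⟨fun h => h.ne, fun h => hs.1 (hu a) (hu b) h⟩
  have hk : 0 < G.maxDegree := by
    rw [Nat.pos_iff_ne_zero]
    intro h0
    rw [h0] at hcf
    obtain ⟨v⟩ := hconn.nonempty
    exact hcf {v} (by constructor <;> simp)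
  obtain ⟨c, hc⟩ := b_main G hconn hk (fun v => by convert hd v) hcf hoddcycle univ
  refine SimpleGraph.chromaticNumber_le_iff_colorable.2 ⟨SimpleGraph.Coloring.mk c ?_⟩
  intro a b hab
  exact hc a (mem_univ _) b (mem_univ _) hab
end

section
/- Alon–Tarsi theorem: Let D be an orientation of a finite simple graph G, and for each vertex v let d⁺(v) denote the in-degree of v in D. If the number of even Eulerian subgraphs of D differs from the number of odd Eulerian subgraphs of D, then for every assignment of lists L(v) of colors to the vertices with |L(v)| ≥ d⁺(v) + 1 for every vertex v, there exists a proper coloring of G in which each vertex v receives a color from its list L(v). In particular, if the maximum in-degree of D is k, then G is list (k+1)-colorable. -/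
/-- `D` is an orientation of `G`: every directed edge of `D` is an edge of `G`, and every
edge of `G` receives exactly one of its two possible directions. -/
def IsOrientation {V : Type*} (G : SimpleGraph V) (D : V → V → Bool) : Prop :=
  (∀ u w, D u w = true → G.Adj u w) ∧ (∀ u w, G.Adj u w → D u w ≠ D w u)

/-- `F` is an Eulerian subgraph of the orientation `D`: a set of directed edges of `D`
in which every vertex has equal in-degree and out-degree. -/
def IsEulerianSubgraph {V : Type*} [Fintype V] [DecidableEq V] (D : V → V → Bool)
    (F : Finset (V × V)) : Prop :=
  (∀ p ∈ F, D p.1 p.2 = true) ∧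
    ∀ v : V, (F.filter (fun p => p.2 = v)).card = (F.filter (fun p => p.1 = v)).card

open MvPolynomial Finset in
theorem at_expand {V : Type*} [DecidableEq V] (E : Finset (V × V)) :
    (∏ p ∈ E, ((X p.2 : MvPolynomial V ℤ) - X p.1)) =
      ∑ F ∈ E.powerset, monomial ((∑ p ∈ E \ F, Finsupp.single p.2 1) +
        ∑ p ∈ F, Finsupp.single p.1 1) ((-1 : ℤ) ^ F.card) := by
  have h : ∀ p ∈ E, ((X p.2 : MvPolynomial V ℤ) - X p.1) = (-X p.1) + X p.2 := by
    intro p _; ring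
  rw [Finset.prod_congr rfl h, Finset.prod_add]
  refine Finset.sum_congr rfl fun F _ => ?_
  have h1 : ∀ (S : Finset (V × V)) (g : V × V → V), (∏ p ∈ S, (X (g p) : MvPolynomial V ℤ)) =
      monomial (∑ p ∈ S, Finsupp.single (g p) 1) 1 := by
    intro S g
    rw [monomial_sum_one]; rfl
  rw [Finset.prod_neg, h1 F Prod.fst, h1 (E \ F) Prod.snd]
  have h2 : ((-1 : MvPolynomial V ℤ)) ^ F.card = C ((-1) ^ F.card) := by simp
  rw [h2, C_mul_monomial, monomial_mul]
  simp [add_comm]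

theorem at_sum_apply {V : Type*} [DecidableEq V] (S : Finset (V × V)) (g : V × V → V) (v : V) :
    (∑ p ∈ S, Finsupp.single (g p) (1 : ℕ)) v = (S.filter (fun p => g p = v)).card := by
  rw [Finsupp.finsetSum_apply, Finset.card_filter]
  simp [Finsupp.single_apply]

open MvPolynomial Finset in
theorem at_coeff {V : Type*} [Fintype V] [DecidableEq V] (D : V → V → Bool) :
    coeff (∑ p ∈ univ.filter (fun p : V × V => D p.1 p.2 = true), Finsupp.single p.2 1)
      (∏ p ∈ univ.filter (fun p : V × V => D p.1 p.2 = true),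
        ((X p.2 : MvPolynomial V ℤ) - X p.1)) =
    (Nat.card {F : Finset (V × V) // IsEulerianSubgraph D F ∧ Even F.card} : ℤ) -
      Nat.card {F : Finset (V × V) // IsEulerianSubgraph D F ∧ Odd F.card} := by
  classical
  set E := univ.filter (fun p : V × V => D p.1 p.2 = true) with hE
  rw [at_expand, coeff_sum]
  have key : ∀ F ∈ E.powerset, ((∑ p ∈ E \ F, Finsupp.single p.2 1) +
        ∑ p ∈ F, Finsupp.single p.1 1 = ∑ p ∈ E, Finsupp.single p.2 (1 : ℕ)) ↔
        IsEulerianSubgraph D F := by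
    intro F hF
    rw [Finset.mem_powerset] at hF
    rw [← Finset.sum_sdiff hF, add_right_inj, Finsupp.ext_iff]
    have : ∀ p ∈ F, D p.1 p.2 = true := fun p hp => by simpa [hE] using hF hp
    simp only [IsEulerianSubgraph, at_sum_apply F Prod.fst, at_sum_apply F Prod.snd]
    exact ⟨fun h => ⟨this, fun v => (h v).symm⟩, fun h v => (h.2 v).symm⟩
  have h1 : ∀ F ∈ E.powerset, coeff (∑ p ∈ E, Finsupp.single p.2 1)
      (monomial ((∑ p ∈ E \ F, Finsupp.single p.2 1) +
        ∑ p ∈ F, Finsupp.single p.1 1) ((-1 : ℤ) ^ F.card)) =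
      (if IsEulerianSubgraph D F ∧ Even F.card then 1 else 0) -
      (if IsEulerianSubgraph D F ∧ Odd F.card then 1 else 0) := by
    intro F hF
    rw [coeff_monomial]
    simp only [key F hF]
    by_cases h : IsEulerianSubgraph D F
    · rcases Nat.even_or_odd F.card with h' | h'
      · simp [h, h', Nat.not_odd_iff_even.2 h', h'.neg_one_pow]
      · simp [h, h', Nat.not_even_iff_odd.2 h', h'.neg_one_pow]
    · simp [h]
  rw [Finset.sum_congr rfl h1, Finset.sum_sub_distrib]
  have h2 : ∀ (P : Finset (V × V) → Prop) [DecidablePred P], (∑ F ∈ E.powerset,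
      (if IsEulerianSubgraph D F ∧ P F then (1 : ℤ) else 0)) =
      Nat.card {F : Finset (V × V) // IsEulerianSubgraph D F ∧ P F} := by
    intro P _
    rw [Nat.card_eq_fintype_card, Fintype.card_subtype, Finset.sum_boole]
    congr 2
    ext F
    simp only [Finset.mem_filter, Finset.mem_powerset, Finset.mem_univ, true_and,
      and_iff_right_iff_imp]
    intro h p hp
    simpa [hE] using h.1.1 p hp
  rw [h2 (fun F => Even F.card), h2 (fun F => Odd F.card)]

/-- The Alon–Tarsi theorem: if `D` is an orientation of `G` in which the numbers of even
and odd Eulerian subgraphs differ, then `G` can be properly colored from any lists whose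
sizes exceed the in-degrees of the vertices. -/
theorem alon_tarsi {V α : Type*} [Fintype V] [DecidableEq V] [DecidableEq α]
    (G : SimpleGraph V) (D : V → V → Bool) (hD : IsOrientation G D)
    (heuler : Nat.card {F : Finset (V × V) // IsEulerianSubgraph D F ∧ Even F.card} ≠
      Nat.card {F : Finset (V × V) // IsEulerianSubgraph D F ∧ Odd F.card})
    (L : V → Finset α)
    (hL : ∀ x : V, (Finset.univ.filter (fun u => D u x = true)).card + 1 ≤ (L x).card) :
    ∃ f : V → α, (∀ x : V, f x ∈ L x) ∧ ∀ x y : V, G.Adj x y → f x ≠ f y := by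
  classical
  obtain ⟨g, hg⟩ : ∃ g : α → ℤ, Set.InjOn g (Finset.univ.biUnion L : Finset α) := by
    let U := Finset.univ.biUnion L
    refine ⟨fun a => if h : a ∈ U then ((U.equivFin ⟨a, h⟩ : ℕ) : ℤ) else 0, ?_⟩
    intro a ha b hb hab
    have ha' : a ∈ U := ha
    have hb' : b ∈ U := hb
    simp only [ha', hb', dif_pos] at hab
    have := U.equivFin.injective (Fin.ext (Int.ofNat.inj hab))
    exact congrArg Subtype.val this
  have hc := at_coeff D
  have hne := hc.trans_ne (sub_ne_zero.2 (Nat.cast_injective.ne heuler))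
  set E := Finset.univ.filter (fun p : V × V => D p.1 p.2 = true) with hE
  have hom : (∏ p ∈ E, ((MvPolynomial.X p.2 : MvPolynomial V ℤ) - MvPolynomial.X p.1)).IsHomogeneous
      (∑ p ∈ E, 1) :=
    MvPolynomial.IsHomogeneous.prod _ _ _ fun p _ =>
      (MvPolynomial.isHomogeneous_X _ _).sub (MvPolynomial.isHomogeneous_X _ _)
  have hdeg := hom.totalDegree (fun h => hne (by rw [h]; simp))
  obtain ⟨s, hs, hs'⟩ := MvPolynomial.combinatorial_nullstellensatz_exists_eval_nonzero _ _ hne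
    (by rw [hdeg, map_sum]; simp) (fun v => (L v).image g) (by
      intro v
      rw [Finset.card_image_of_injOn (hg.mono fun a ha => by
        simp only [Finset.coe_biUnion, Set.mem_iUnion]; exact ⟨v, by simp, ha⟩)]
      rw [at_sum_apply E Prod.snd]
      refine lt_of_lt_of_le (Nat.lt_succ_of_le ?_) (hL v)
      refine Finset.card_le_card_of_injOn Prod.fst ?_ ?_
      · rintro ⟨a, b⟩ h
        simp [hE] at h ⊢
        rw [← h.2]; exact h.1
      · rintro ⟨a, b⟩ h ⟨c, d⟩ h' h''
        simp at h h' h''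
        rw [h'', h.2, h'.2])
  simp only [Finset.mem_image] at hs
  choose f hf hfs using hs
  refine ⟨f, hf, ?_⟩
  have main : ∀ x y, D x y = true → f x ≠ f y := by
    intro x y hxy he
    apply hs'
    rw [map_prod]
    refine Finset.prod_eq_zero (i := (x, y)) (by simp [hE, hxy]) ?_
    simp [← hfs, he]
  intro x y hxy
  have := hD.2 x y hxy
  cases h : D x y
  · refine (main y x ?_).symm
    rw [h] at this
    simpa using this.symm
  · exact main x y h
end
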